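/- arXiv:1310.3436 — 11 statements merged into one kernel-verified Lean document; each statement's English description precedes it below -/
import Mathlib

section
/- There exists a constant C > 0 such that for every integer n ≥ 3, the dimensionless magnetostatic energy Ē(n) of a circular ring of n tangentially magnetized spheres satisfies |Ē(n) + 2ζ(3)·n − (ζ(3) + 1/6)·π²/n| ≤ C/n², where ζ(3) = Σ_{k≥1} 1/k³. That is, Ē(n) = −2ζ(3)·n + (ζ(3) + 1/6)·π²·n⁻¹ + O(n⁻²) as n → ∞. -/
open Real Filter

/-- Euclidean dot product on `ℝ × ℝ`. -/
noncomputable def dot2 (x y : ℝ × ℝ) : ℝ := x.1 * y.1 + x.2 * y.2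

/-- Euclidean norm on `ℝ × ℝ`. -/
noncomputable def nrm2 (x : ℝ × ℝ) : ℝ := Real.sqrt (dot2 x x)

/-- The radius `R_n = 1/(2 n sin(π/n))` of the circular ring of `n` magnets. -/
noncomputable def ringR (n : ℕ) : ℝ := 1 / (2 * n * Real.sin (π / n))

/-- Position of the `i`-th magnet on the ring of `n` magnets. -/
noncomputable def ringPos (n i : ℕ) : ℝ × ℝ :=
  (ringR n * Real.cos (2 * π * i / n), ringR n * Real.sin (2 * π * i / n))

/-- Unit tangential dipole direction of the `i`-th magnet. -/
noncomputable def ringDip (n i : ℕ) : ℝ × ℝ :=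
  (-Real.sin (2 * π * i / n), Real.cos (2 * π * i / n))

/-- Dimensionless total dipole–dipole energy of the ring of `n` magnets. -/
noncomputable def ringEnergy (n : ℕ) : ℝ :=
  -(1 / (2 * (n : ℝ) ^ 3)) *
    ∑ i ∈ Finset.range n, ∑ j ∈ Finset.range n,
      if i = j then 0 else
        (3 * dot2 (ringPos n i - ringPos n j) (ringDip n j) *
            dot2 (ringPos n i - ringPos n j) (ringDip n i) -
          nrm2 (ringPos n i - ringPos n j) ^ 2 * dot2 (ringDip n i) (ringDip n j)) /
        nrm2 (ringPos n i - ringPos n j) ^ 5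

/-- Apéry's constant `ζ(3) = Σ_{k ≥ 1} 1/k³`. -/
noncomputable def zeta3 : ℝ := ∑' k : ℕ, 1 / ((k : ℝ) + 1) ^ 3

theorem exists_sin_eq_taylor {y : ℝ} (hy : 0 < y) :
    ∃ α : ℝ, |α| ≤ 3 ∧ sin y = y * (1 - y ^ 2 / 6 + α * (y ^ 2) ^ 2) := by
  have hy5 : 0 < y ^ 5 := by positivity
  refine ⟨(sin y - (y - y ^ 3 / 6)) / y ^ 5, ?_, by field_simp; ring⟩
  rw [abs_div, abs_of_pos hy5, div_le_iff₀ hy5]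
  rcases le_total y 1 with h | h
  · have := Real.sin_bound (x := y) (by rwa [abs_of_pos hy])
    rw [abs_of_pos hy] at this
    linarith
  · have h1 : 1 ≤ y ^ 5 := one_le_pow₀ h
    have h3 : y ^ 3 ≤ y ^ 5 := pow_le_pow_right₀ h (by norm_num)
    rw [abs_le]
    constructor <;> linarith [sin_le_one y, sin_ge_sub_cube hy.le, pow_pos hy 3]

theorem exists_cos_eq_taylor {y : ℝ} (hy : 0 < y) :
    ∃ β : ℝ, |β| ≤ 3 ∧ cos y = 1 - y ^ 2 / 2 + β * (y ^ 2) ^ 2 := by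
  have hy4 : 0 < y ^ 4 := by positivity
  refine ⟨(cos y - (1 - y ^ 2 / 2)) / y ^ 4, ?_, by field_simp; ring⟩
  rw [abs_div, abs_of_pos hy4, div_le_iff₀ hy4]
  rcases le_total y 1 with h | h
  · have := Real.cos_bound (x := y) (by rwa [abs_of_pos hy])
    rw [abs_of_pos hy] at this
    linarith
  · have h1 : 1 ≤ y ^ 4 := one_le_pow₀ h
    have h3 : y ^ 2 ≤ y ^ 4 := pow_le_pow_right₀ h (by norm_num)
    rw [abs_le]
    constructor <;> linarith [cos_le_one y, one_sub_sq_div_two_le_cos (x := y), pow_pos hy 2]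

/-- A continuous function of a bounded triple of reals is bounded. -/
theorem exists_pos_bound_of_continuous₃ {f : ℝ × ℝ × ℝ → ℝ} (hf : Continuous f) (r : ℝ) :
    ∃ M : ℝ, 0 < M ∧ ∀ a b c : ℝ, |a| ≤ r → |b| ≤ r → |c| ≤ r → |f (a, b, c)| ≤ M := by
  obtain ⟨M, hM⟩ := (isCompact_closedBall (0 : ℝ × ℝ × ℝ) r).exists_bound_of_continuousOn
    hf.continuousOn
  refine ⟨|M| + 1, by positivity, fun a b c ha hb hc => ?_⟩
  have h := hM (a, b, c) (by simp [Prod.norm_def, ha, hb, hc])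
  rw [Real.norm_eq_abs] at h
  linarith [le_abs_self M]

theorem half_le_sin {y : ℝ} (hy : 0 < y) (hy' : y ≤ π / 2) : y / 2 ≤ sin y := by
  refine le_trans ?_ (mul_le_sin hy.le hy')
  have h : 1 / 2 ≤ 2 / π := by
    rw [div_le_div_iff₀ (by norm_num) pi_pos]
    linarith [pi_le_four]
  nlinarith

theorem exists_bound_deriv_csc_near_zero :
    ∃ M : ℝ, 0 < M ∧ ∀ y : ℝ, 0 < y → y ≤ π / 2 →
      |6 / y ^ 4 - 6 * cos y / sin y ^ 4 + cos y / sin y ^ 2| ≤ M := by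
  set f : ℝ × ℝ × ℝ → ℝ := fun p =>
      24 * p.2.1 + 36 * (-1 / 6 + p.2.1 * p.1) ^ 2 + 24 * p.1 * (-1 / 6 + p.2.1 * p.1) ^ 3
        + 6 * p.1 ^ 2 * (-1 / 6 + p.2.1 * p.1) ^ 4 - 6 * p.2.2
        + (-1 / 2 + p.2.2 * p.1) * (1 + p.1 * (-1 / 6 + p.2.1 * p.1)) ^ 2
        + 2 * (-1 / 6 + p.2.1 * p.1) + p.1 * (-1 / 6 + p.2.1 * p.1) ^ 2 with hf
  obtain ⟨M, hM, hbound⟩ := exists_pos_bound_of_continuous₃ (f := f) (by fun_prop) 4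
  refine ⟨16 * M, by positivity, fun y hy hy' => ?_⟩
  obtain ⟨α, hα, hs⟩ := exists_sin_eq_taylor hy
  obtain ⟨β, hβ, hc⟩ := exists_cos_eq_taylor hy
  have hlow := half_le_sin hy hy'
  have hy2 : |y ^ 2| ≤ 4 := by
    rw [abs_of_pos (by positivity)]
    nlinarith [pi_le_four]
  have hb := hbound (y ^ 2) α β hy2 (by linarith) (by linarith)
  set σ := 1 - y ^ 2 / 6 + α * (y ^ 2) ^ 2 with hσ
  have hσ2 : 1 / 2 ≤ σ := by
    rw [hs] at hlow
    by_contra! h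
    nlinarith
  have hσ0 : 0 < σ := by linarith
  have hσ4 : (1 / 2) ^ 4 ≤ σ ^ 4 := pow_le_pow_left₀ (by norm_num) hσ2 4
  set P := f (y ^ 2, α, β) with hP
  have key : 6 / y ^ 4 - 6 * cos y / sin y ^ 4 + cos y / sin y ^ 2 = P / σ ^ 4 := by
    rw [hs]
    have : 6 / y ^ 4 - 6 * cos y / (y * σ) ^ 4 + cos y / (y * σ) ^ 2
        = (6 * σ ^ 4 - 6 * cos y + cos y * σ ^ 2 * y ^ 2) / y ^ 4 / σ ^ 4 := by
      field_simp
    rw [this]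
    congr 1
    rw [div_eq_iff (by positivity), hc, hσ, hP, hf]
    ring
  rw [key, abs_div, abs_of_pos (pow_pos hσ0 4), div_le_iff₀ (pow_pos hσ0 4)]
  nlinarith

theorem exists_bound_cos_div_sin_sq_near_zero :
    ∃ M : ℝ, 0 < M ∧ ∀ y : ℝ, 0 < y → y ≤ π / 2 →
      |1 / y ^ 2 - cos y / sin y ^ 2 - 1 / 6| ≤ M * y := by
  set f : ℝ × ℝ × ℝ → ℝ := fun p =>
      2 * p.2.1 + (-1 / 6 + p.2.1 * p.1) ^ 2 - p.2.2
        - (2 * (-1 / 6 + p.2.1 * p.1) + p.1 * (-1 / 6 + p.2.1 * p.1) ^ 2) / 6 with hf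
  obtain ⟨M, hM, hbound⟩ := exists_pos_bound_of_continuous₃ (f := f) (by fun_prop) 4
  refine ⟨8 * M, by positivity, fun y hy hy' => ?_⟩
  obtain ⟨α, hα, hs⟩ := exists_sin_eq_taylor hy
  obtain ⟨β, hβ, hc⟩ := exists_cos_eq_taylor hy
  have hlow := half_le_sin hy hy'
  have hy2' : y ≤ 2 := by linarith [pi_le_four]
  have hy2 : |y ^ 2| ≤ 4 := by
    rw [abs_of_pos (by positivity)]
    nlinarith
  have hb := hbound (y ^ 2) α β hy2 (by linarith) (by linarith)
  set σ := 1 - y ^ 2 / 6 + α * (y ^ 2) ^ 2 with hσ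
  have hσ2 : 1 / 2 ≤ σ := by
    rw [hs] at hlow
    by_contra! h
    nlinarith
  have hσ0 : 0 < σ := by linarith
  have hσ4 : (1 / 2) ^ 2 ≤ σ ^ 2 := pow_le_pow_left₀ (by norm_num) hσ2 2
  set P := f (y ^ 2, α, β) with hP
  have key : 1 / y ^ 2 - cos y / sin y ^ 2 - 1 / 6 = y * (y * P / σ ^ 2) := by
    rw [hs]
    have : 1 / y ^ 2 - cos y / (y * σ) ^ 2 - 1 / 6
        = (σ ^ 2 - cos y - σ ^ 2 * y ^ 2 / 6) / y ^ 2 / σ ^ 2 := by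
      field_simp
    rw [this, ← mul_div_assoc]
    congr 1
    rw [div_eq_iff (by positivity), hc, hσ, hP, hf]
    ring
  rw [key, abs_mul, abs_of_pos hy, mul_comm]
  gcongr
  rw [abs_div, abs_mul, abs_of_pos hy, abs_of_pos (pow_pos hσ0 2), div_le_iff₀ (pow_pos hσ0 2)]
  have : y * |P| ≤ 2 * M := by gcongr
  nlinarith

theorem abs_sum_one_div_cube_sub_le {n : ℕ} (hn : 1 ≤ n) :
    |∑ k ∈ Finset.Ico 1 n, 1 / (k : ℝ) ^ 3 - (zeta3 - 1 / (2 * (n : ℝ) ^ 2))| ≤ 1 / (n : ℝ) ^ 3 := by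
  set S : ℕ → ℝ := fun m => ∑ k ∈ Finset.range m, 1 / ((k : ℝ) + 1) ^ 3 with hS
  have hlim : Tendsto S atTop (nhds zeta3) := by
    have hsum : Summable fun k : ℕ => 1 / ((k : ℝ) + 1) ^ 3 := by
      have := (summable_nat_add_iff 1).2 (Real.summable_one_div_nat_pow.2 (by norm_num : 1 < 3))
      simpa using this
    exact hsum.hasSum.tendsto_sum_nat
  have hinv : Tendsto (fun m : ℕ => 1 / ((m : ℝ) + 1)) atTop (nhds 0) :=
    tendsto_one_div_add_atTop_nhds_zero_nat
  have hinv2 : Tendsto (fun m : ℕ => S m + (1 / ((m : ℝ) + 1)) ^ 2 / 2) atTop (nhds zeta3) := by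
    simpa using hlim.add ((hinv.pow 2).div_const 2)
  have hinv3 : Tendsto (fun m : ℕ => S m + (1 / ((m : ℝ) + 1)) ^ 2 / 2 + (1 / ((m : ℝ) + 1)) ^ 3)
      atTop (nhds zeta3) := by
    simpa using hinv2.add (hinv.pow 3)
  have hmono : Monotone fun m : ℕ => S m + (1 / ((m : ℝ) + 1)) ^ 2 / 2 := by
    refine monotone_nat_of_le_succ fun m => ?_
    simp only [hS, Finset.sum_range_succ]
    push_cast
    have hm : (0 : ℝ) ≤ m := m.cast_nonneg
    rw [← sub_nonneg]
    have : ∀ s : ℝ, s + 1 / ((m : ℝ) + 1) ^ 3 + (1 / ((m : ℝ) + 1 + 1)) ^ 2 / 2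
        - (s + (1 / ((m : ℝ) + 1)) ^ 2 / 2)
        = (3 * m + 5) / (2 * (m + 1) ^ 3 * (m + 2) ^ 2) := by
      intro s
      rw [show (m : ℝ) + 1 + 1 = m + 2 by ring]
      field_simp
      ring
    rw [this]
    positivity
  have hanti : Antitone fun m : ℕ =>
      S m + (1 / ((m : ℝ) + 1)) ^ 2 / 2 + (1 / ((m : ℝ) + 1)) ^ 3 := by
    refine antitone_nat_of_succ_le fun m => ?_
    simp only [hS, Finset.sum_range_succ]
    push_cast
    have hm : (0 : ℝ) ≤ m := m.cast_nonneg
    rw [← sub_nonneg]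
    have : ∀ s : ℝ, s + (1 / ((m : ℝ) + 1)) ^ 2 / 2 + (1 / ((m : ℝ) + 1)) ^ 3
        - (s + 1 / ((m : ℝ) + 1) ^ 3 + (1 / ((m : ℝ) + 1 + 1)) ^ 2 / 2
          + (1 / ((m : ℝ) + 1 + 1)) ^ 3)
        = (3 * m + 4) / (2 * (m + 1) ^ 2 * (m + 2) ^ 3) := by
      intro s
      rw [show (m : ℝ) + 1 + 1 = m + 2 by ring]
      field_simp
      ring
    rw [this]
    positivity
  obtain ⟨m, rfl⟩ : ∃ m, n = m + 1 := ⟨n - 1, by omega⟩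
  have h1 := hmono.ge_of_tendsto hinv2 m
  have h2 := hanti.le_of_tendsto hinv3 m
  have h3 : ∑ k ∈ Finset.Ico 1 (m + 1), 1 / (k : ℝ) ^ 3 = S m := by
    rw [Finset.sum_Ico_eq_sum_range]
    simp [hS, add_comm]
  rw [h3]
  push_cast
  have e2 : 1 / (2 * ((m : ℝ) + 1) ^ 2) = (1 / ((m : ℝ) + 1)) ^ 2 / 2 := by
    rw [one_div_pow]; field_simp
  have e3 : 1 / ((m : ℝ) + 1) ^ 3 = (1 / ((m : ℝ) + 1)) ^ 3 := by rw [one_div_pow]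
  have e4 : 0 ≤ (1 / ((m : ℝ) + 1)) ^ 3 := by positivity
  rw [e2, e3, abs_le]
  constructor <;> linarith

/-- The second derivative `2 csc³ - csc` of the cosecant. -/
noncomputable def cscDD (y : ℝ) : ℝ := 2 / sin y ^ 3 - 1 / sin y

/-- `cscDD` with its poles at `0` and `π` removed. -/
noncomputable def regCsc (y : ℝ) : ℝ := cscDD y - 2 / y ^ 3 - 2 / (π - y) ^ 3

/-- A primitive of `regCsc` on `(0, π)`. -/
noncomputable def regCscPrim (y : ℝ) : ℝ := 1 / y ^ 2 - cos y / sin y ^ 2 - 1 / (π - y) ^ 2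

theorem hasDerivAt_one_div_sq {y : ℝ} (hy : y ≠ 0) :
    HasDerivAt (fun t : ℝ => 1 / t ^ 2) (-2 / y ^ 3) y := by
  have hd := (hasDerivAt_const y (1 : ℝ)).fun_div ((hasDerivAt_id y).fun_pow 2) (pow_ne_zero 2 hy)
  refine hd.congr_deriv ?_
  simp only [id]
  norm_num
  field_simp

theorem hasDerivAt_cos_div_sin_sq {y : ℝ} (hs : sin y ≠ 0) :
    HasDerivAt (fun t : ℝ => cos t / sin t ^ 2) (-cscDD y) y := by
  have hd := (hasDerivAt_cos y).fun_div ((hasDerivAt_sin y).fun_pow 2) (pow_ne_zero 2 hs)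
  refine hd.congr_deriv ?_
  rw [cscDD]
  norm_num
  field_simp
  rw [cos_sq']
  ring

theorem hasDerivAt_regCscPrim {y : ℝ} (hy : y ∈ Set.Ioo 0 π) :
    HasDerivAt regCscPrim (regCsc y) y := by
  have h1 : π - y ≠ 0 := (sub_pos.2 hy.2).ne'
  have hd := ((hasDerivAt_one_div_sq hy.1.ne').sub
    (hasDerivAt_cos_div_sin_sq (sin_pos_of_mem_Ioo hy).ne')).sub
    ((hasDerivAt_one_div_sq h1).comp y ((hasDerivAt_id y).const_sub π))
  refine hd.congr_deriv ?_
  rw [regCsc]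
  ring

theorem hasDerivAt_regCsc {y : ℝ} (hy : y ∈ Set.Ioo 0 π) :
    HasDerivAt regCsc
      (6 / y ^ 4 - 6 * cos y / sin y ^ 4 + cos y / sin y ^ 2 - 6 / (π - y) ^ 4) y := by
  have hs : sin y ≠ 0 := (sin_pos_of_mem_Ioo hy).ne'
  have h0 : y ≠ 0 := hy.1.ne'
  have h1 : π - y ≠ 0 := (sub_pos.2 hy.2).ne'
  have hd := ((((hasDerivAt_const y (2 : ℝ)).div ((hasDerivAt_sin y).pow 3) (pow_ne_zero 3 hs)).sub
    ((hasDerivAt_const y (1 : ℝ)).div (hasDerivAt_sin y) hs)).sub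
    ((hasDerivAt_const y (2 : ℝ)).div ((hasDerivAt_id y).pow 3) (pow_ne_zero 3 h0))).sub
    ((hasDerivAt_const y (2 : ℝ)).div (((hasDerivAt_id y).const_sub π).pow 3) (pow_ne_zero 3 h1))
  refine hd.congr_deriv ?_
  simp only [id, Pi.pow_apply]
  norm_num
  field_simp
  ring

theorem exists_bound_deriv_regCsc :
    ∃ M : ℝ, 0 < M ∧ ∀ y ∈ Set.Ioo 0 π, |deriv regCsc y| ≤ M := by
  obtain ⟨M, hM, hb⟩ := exists_bound_deriv_csc_near_zero
  have half : ∀ y : ℝ, 0 < y → y ≤ π / 2 → |6 / y ^ 4 - 6 * cos y / sin y ^ 4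
      + cos y / sin y ^ 2 - 6 / (π - y) ^ 4| ≤ M + 6 := by
    intro y hy hy'
    have h1 : 1 ≤ (π - y) ^ 4 := one_le_pow₀ (by linarith [pi_gt_three])
    have h2 : 6 / (π - y) ^ 4 ≤ 6 := div_le_self (by norm_num) h1
    have h3 : 0 ≤ 6 / (π - y) ^ 4 := by positivity
    have := abs_le.1 (hb y hy hy')
    rw [abs_le]
    constructor <;> linarith
  refine ⟨M + 6, by positivity, fun y hy => ?_⟩
  rw [(hasDerivAt_regCsc hy).deriv]
  rcases le_total y (π / 2) with h | h
  · exact half y hy.1 h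
  · have := half (π - y) (by linarith [hy.2]) (by linarith)
    rw [cos_pi_sub, sin_pi_sub, sub_sub_cancel, ← abs_neg] at this
    convert this using 2
    ring

theorem abs_regCsc_sub_le {M : ℝ} (hM : ∀ y ∈ Set.Ioo 0 π, |deriv regCsc y| ≤ M) {a b : ℝ}
    (ha : a ∈ Set.Ioo 0 π) (hb : b ∈ Set.Ioo 0 π) :
    |regCsc b - regCsc a| ≤ M * |b - a| :=
  (convex_Ioo 0 π).norm_image_sub_le_of_norm_deriv_le
    (fun _ hx => (hasDerivAt_regCsc hx).differentiableAt) hM ha hb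

theorem abs_regCscPrim_step_le {M : ℝ} (hM : ∀ y ∈ Set.Ioo 0 π, |deriv regCsc y| ≤ M) {y x : ℝ}
    (hx : 0 ≤ x) (hy : 0 < y) (hyx : y + x < π) :
    |regCscPrim (y + x) - regCscPrim y - x * regCsc y| ≤ M * x ^ 2 := by
  have hM0 : 0 ≤ M := (abs_nonneg _).trans (hM y ⟨hy, by linarith⟩)
  have hsub : ∀ t ∈ Set.Icc y (y + x), t ∈ Set.Ioo 0 π := fun t ht =>
    ⟨by linarith [ht.1], by linarith [ht.2]⟩
  have h := (convex_Icc y (y + x)).norm_image_sub_le_of_norm_hasDerivWithin_le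
    (f := fun t => regCscPrim t - t * regCsc y) (f' := fun t => regCsc t - 1 * regCsc y)
    (C := M * x) (x := y) (y := y + x)
    (fun t ht => ((hasDerivAt_regCscPrim (hsub t ht)).sub
      ((hasDerivAt_id t).mul_const (regCsc y))).hasDerivWithinAt)
    (fun t ht => by
      rw [one_mul]
      refine (abs_regCsc_sub_le hM (hsub y ⟨le_rfl, by linarith⟩) (hsub t ht)).trans ?_
      gcongr
      rw [abs_of_nonneg (by linarith [ht.1])]
      linarith [ht.2])
    ⟨le_rfl, by linarith⟩ ⟨by linarith, le_rfl⟩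
  rw [Real.norm_eq_abs, Real.norm_eq_abs, add_sub_cancel_left, abs_of_nonneg hx] at h
  calc _ = |regCscPrim (y + x) - (y + x) * regCsc y - (regCscPrim y - y * regCsc y)| := by
        congr 1; ring
    _ ≤ M * x * x := h
    _ = M * x ^ 2 := by ring

theorem regCscPrim_pi_sub (y : ℝ) : regCscPrim (π - y) = -regCscPrim y := by
  rw [regCscPrim, regCscPrim, cos_pi_sub, sin_pi_sub, sub_sub_cancel]
  ring

theorem exists_bound_regCscPrim_near_zero :
    ∃ M : ℝ, 0 < M ∧ ∀ y : ℝ, 0 < y → y ≤ π / 2 →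
      |regCscPrim y - (1 / 6 - 1 / π ^ 2)| ≤ M * y := by
  obtain ⟨M, hM, hb⟩ := exists_bound_cos_div_sin_sq_near_zero
  refine ⟨M + 1, by positivity, fun y hy hy' => ?_⟩
  have hπ := pi_gt_three
  have h1 : 1 ≤ (π - y) ^ 2 := one_le_pow₀ (by linarith)
  have h0 : π - y ≠ 0 := by linarith
  have e : 1 / (π - y) ^ 2 - 1 / π ^ 2 = y * (2 * π - y) / (π ^ 2 * (π - y) ^ 2) := by
    field_simp
    ring
  have h2 : |1 / (π - y) ^ 2 - 1 / π ^ 2| ≤ y := by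
    rw [e, abs_of_nonneg (div_nonneg (mul_nonneg hy.le (by linarith)) (by positivity)),
      div_le_iff₀ (by positivity)]
    gcongr
    nlinarith [pow_pos pi_pos 2]
  calc |regCscPrim y - (1 / 6 - 1 / π ^ 2)|
      = |(1 / y ^ 2 - cos y / sin y ^ 2 - 1 / 6) - (1 / (π - y) ^ 2 - 1 / π ^ 2)| := by
        rw [regCscPrim]; congr 1; ring
    _ ≤ M * y + y := (abs_sub _ _).trans (add_le_add (hb y hy hy') h2)
    _ = (M + 1) * y := by ring

theorem abs_regCscPrim_sub_sum_le {M : ℝ} (hM : ∀ y ∈ Set.Ioo 0 π, |deriv regCsc y| ≤ M) {x : ℝ}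
    (hx : 0 < x) (m : ℕ) (hm : (m + 1) * x < π) :
    |regCscPrim ((m + 1) * x) - regCscPrim x - x * ∑ k ∈ Finset.Ico 1 (m + 1), regCsc (k * x)|
      ≤ m * (M * x ^ 2) := by
  induction m with
  | zero => simp
  | succ m ih =>
    push_cast at hm ⊢
    have h1 := ih (by nlinarith)
    have h2 := abs_regCscPrim_step_le hM hx.le (y := (m + 1) * x) (by positivity) (by linarith)
    rw [Finset.sum_Ico_succ_top (by omega)]
    calc _ = |(regCscPrim ((m + 1) * x + x) - regCscPrim ((m + 1) * x)
          - x * regCsc ((m + 1) * x)) + (regCscPrim ((m + 1) * x) - regCscPrim x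
          - x * ∑ k ∈ Finset.Ico 1 (m + 1), regCsc (k * x))| := by
          congr 1
          push_cast
          rw [show ((m : ℝ) + 1 + 1) * x = (m + 1) * x + x by ring]
          ring
      _ ≤ M * x ^ 2 + m * (M * x ^ 2) := (abs_add_le _ _).trans (add_le_add h2 h1)
      _ = _ := by ring

theorem exists_bound_sum_regCsc :
    ∃ C : ℝ, 0 < C ∧ ∀ n : ℕ, 3 ≤ n →
      |∑ k ∈ Finset.Ico 1 n, regCsc (k * (π / n)) + 2 / (π / n) * (1 / 6 - 1 / π ^ 2)| ≤ C := by
  obtain ⟨M, hM0, hM⟩ := exists_bound_deriv_regCsc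
  obtain ⟨K, hK0, hK⟩ := exists_bound_regCscPrim_near_zero
  refine ⟨M * π + 2 * K + (|regCsc (π / 2)| + M * π), by positivity, fun n hn => ?_⟩
  obtain ⟨m, rfl⟩ : ∃ m, n = m + 2 := ⟨n - 2, by omega⟩
  set x : ℝ := π / (m + 2 : ℕ) with hx
  have hn3 : (3 : ℝ) ≤ (m + 2 : ℕ) := by exact_mod_cast hn
  have hn0 : (0 : ℝ) < (m + 2 : ℕ) := by linarith
  have hx0 : 0 < x := div_pos pi_pos hn0
  have hxn : ((m : ℝ) + 2) * x = π := by
    rw [hx]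
    push_cast
    field_simp
  have hlast : ((m : ℝ) + 1) * x = π - x := by linarith
  have hx2 : x ≤ π / 2 := by
    rw [hx]
    gcongr
    linarith
  have h1 := abs_regCscPrim_sub_sum_le hM hx0 m (by linarith)
  have h2 := hK x hx0 hx2
  rw [hlast, regCscPrim_pi_sub] at h1
  have h3 : |regCsc (π - x)| ≤ |regCsc (π / 2)| + M * π := by
    have hmem : π - x ∈ Set.Ioo 0 π := ⟨by linarith [pi_pos], by linarith⟩
    have := abs_regCsc_sub_le hM (a := π / 2) ⟨by linarith [pi_pos], by linarith [pi_pos]⟩ hmem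
    have h4 : M * |π - x - π / 2| ≤ M * π := by
      gcongr
      rw [abs_le]
      constructor <;> linarith
    linarith [abs_sub_abs_le_abs_sub (regCsc (π - x)) (regCsc (π / 2))]
  rw [Finset.sum_Ico_succ_top (by omega)]
  push_cast
  rw [hlast]
  set S := ∑ k ∈ Finset.Ico 1 (m + 1), regCsc (k * x)
  set A := (1 : ℝ) / 6 - 1 / π ^ 2
  have h5 : |S + 2 / x * A| ≤ M * π + 2 * K := by
    have e : S + 2 / x * A = (-(-regCscPrim x - regCscPrim x - x * S)
        - 2 * (regCscPrim x - A)) / x := by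
      field_simp
      ring
    rw [e, abs_div, abs_of_pos hx0, div_le_iff₀ hx0]
    refine (abs_sub _ _).trans ?_
    rw [abs_neg, abs_mul, abs_two]
    have h6 : (m : ℝ) * (M * x ^ 2) ≤ M * π * x := by
      rw [← hxn]
      nlinarith [mul_pos hM0 (pow_pos hx0 2)]
    linarith
  calc |S + regCsc (π - x) + 2 / x * A| = |(S + 2 / x * A) + regCsc (π - x)| := by
        congr 1; ring
    _ ≤ _ := (abs_add_le _ _).trans (add_le_add h5 h3)

theorem exists_bound_sum_cscDD :
    ∃ C : ℝ, 0 < C ∧ ∀ n : ℕ, 3 ≤ n →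
      |∑ k ∈ Finset.Ico 1 n, cscDD (k * (π / n))
        - (4 * zeta3 / (π / n) ^ 3 - 1 / (3 * (π / n)))| ≤ C := by
  obtain ⟨C, hC, hb⟩ := exists_bound_sum_regCsc
  refine ⟨1 + C, by positivity, fun n hn => ?_⟩
  have hn0 : (0 : ℝ) < n := by exact_mod_cast (by omega : 0 < n)
  set x : ℝ := π / n with hx
  have hx0 : 0 < x := div_pos pi_pos hn0
  have hxn : (n : ℝ) = π / x := by rw [hx]; field_simp
  have hsplit : ∑ k ∈ Finset.Ico 1 n, cscDD (k * x)
      = 4 / x ^ 3 * ∑ k ∈ Finset.Ico 1 n, 1 / (k : ℝ) ^ 3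
        + ∑ k ∈ Finset.Ico 1 n, regCsc (k * x) := by
    have hrefl : ∑ k ∈ Finset.Ico 1 n, 1 / (((n - k : ℕ) : ℝ)) ^ 3
        = ∑ k ∈ Finset.Ico 1 n, 1 / (k : ℝ) ^ 3 := by
      have := Finset.sum_Ico_reflect (fun k : ℕ => 1 / (k : ℝ) ^ 3) 1 (m := n) (n := n) (by omega)
      simpa using this
    have hterm : ∀ k ∈ Finset.Ico 1 n, cscDD (k * x)
        = 2 / x ^ 3 * (1 / (k : ℝ) ^ 3) + 2 / x ^ 3 * (1 / (((n - k : ℕ) : ℝ)) ^ 3)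
          + regCsc (k * x) := by
      intro k hk
      have hk := Finset.mem_Ico.1 hk
      rw [regCsc, Nat.cast_sub hk.2.le,
        show π - k * x = (n - k) * x by rw [hxn]; field_simp, mul_pow, mul_pow]
      simp only [div_eq_mul_inv, mul_inv]
      ring
    rw [Finset.sum_congr rfl hterm, Finset.sum_add_distrib, Finset.sum_add_distrib,
      ← Finset.mul_sum, ← Finset.mul_sum, hrefl]
    ring
  rw [hsplit]
  have h1 := abs_sum_one_div_cube_sub_le (n := n) (by omega)
  have h2 := hb n hn
  rw [← hx] at h2
  set H := ∑ k ∈ Finset.Ico 1 n, 1 / (k : ℝ) ^ 3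
  set G := ∑ k ∈ Finset.Ico 1 n, regCsc (k * x)
  have h3 : |4 / x ^ 3 * (H - (zeta3 - 1 / (2 * (n : ℝ) ^ 2)))| ≤ 1 := by
    rw [abs_mul, abs_of_pos (by positivity)]
    calc 4 / x ^ 3 * |H - (zeta3 - 1 / (2 * (n : ℝ) ^ 2))| ≤ 4 / x ^ 3 * (1 / (n : ℝ) ^ 3) := by
          gcongr
      _ = 4 / π ^ 3 := by rw [hx]; field_simp
      _ ≤ 1 := by
        rw [div_le_one (by positivity)]
        have := pow_le_pow_left₀ (by norm_num) pi_gt_three.le 3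
        linarith
  have e : 4 / x ^ 3 * H + G - (4 * zeta3 / x ^ 3 - 1 / (3 * x))
      = 4 / x ^ 3 * (H - (zeta3 - 1 / (2 * (n : ℝ) ^ 2))) + (G + 2 / x * (1 / 6 - 1 / π ^ 2)) := by
    rw [hxn]
    have := pi_pos
    field_simp
    ring
  rw [e]
  exact (abs_add_le _ _).trans (add_le_add h3 h2)

/-- The interaction of two dipoles on the ring, up to normalisation, as a function of half the
angle between them; it takes the junk value `0` at multiples of `π`. -/
noncomputable def pairInteraction (t : ℝ) : ℝ := 2 / |sin t| ^ 3 - 1 / |sin t|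

theorem pairInteraction_sub_pi (t : ℝ) : pairInteraction (t - π) = pairInteraction t := by
  rw [pairInteraction, pairInteraction, sin_sub_pi, abs_neg]

theorem pairInteraction_neg (t : ℝ) : pairInteraction (-t) = pairInteraction t := by
  rw [pairInteraction, pairInteraction, sin_neg, abs_neg]

theorem pairInteraction_zero : pairInteraction 0 = 0 := by
  simp [pairInteraction]

theorem dipole_term_eq {R m d : ℝ} (hR : 0 < R) :
    let D : ℝ × ℝ := (R * cos (m + d), R * sin (m + d)) - (R * cos (m - d), R * sin (m - d))
    let u : ℝ × ℝ := (-sin (m + d), cos (m + d))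
    let v : ℝ × ℝ := (-sin (m - d), cos (m - d))
    (3 * dot2 D v * dot2 D u - nrm2 D ^ 2 * dot2 u v) / nrm2 D ^ 5
      = 1 / (8 * R ^ 3) * pairInteraction d := by
  intro D u v
  have hm := sin_sq_add_cos_sq m
  have hd := sin_sq_add_cos_sq d
  have hDD : dot2 D D = (2 * R * |sin d|) ^ 2 := by
    simp only [D, dot2, Prod.mk_sub_mk, cos_add, sin_add, cos_sub, sin_sub, mul_pow, sq_abs]
    linear_combination (4 * R ^ 2 * sin d ^ 2) * hm
  have hDu : dot2 D u = 2 * R * sin d * cos d := by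
    simp only [D, u, dot2, Prod.mk_sub_mk, cos_add, sin_add, cos_sub, sin_sub]
    linear_combination (2 * R * sin d * cos d) * hm
  have hDv : dot2 D v = 2 * R * sin d * cos d := by
    simp only [D, v, dot2, Prod.mk_sub_mk, cos_add, sin_add, cos_sub, sin_sub]
    linear_combination (2 * R * sin d * cos d) * hm
  have huv : dot2 u v = 1 - 2 * |sin d| ^ 2 := by
    simp only [u, v, dot2, cos_add, sin_add, cos_sub, sin_sub, sq_abs]
    linear_combination (cos d ^ 2 - sin d ^ 2) * hm + hd
  have hn : nrm2 D = 2 * R * |sin d| := by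
    rw [nrm2, hDD, sqrt_sq (by positivity)]
  have hnum : 3 * dot2 D v * dot2 D u - nrm2 D ^ 2 * dot2 u v
      = 4 * R ^ 2 * |sin d| ^ 2 * (2 - |sin d| ^ 2) := by
    rw [hDu, hDv, hn, huv]
    simp only [mul_pow, sq_abs]
    linear_combination (12 * R ^ 2 * sin d ^ 2) * hd
  rw [hnum, hn, pairInteraction]
  rcases eq_or_ne |sin d| 0 with h | h
  · simp [h]
  · field_simp
    ring

theorem sum_pairInteraction_sub {n : ℕ} (hn : 0 < n) (i : ℕ) :
    ∑ j ∈ Finset.range n, pairInteraction (((i : ℝ) - j) * (π / n))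
      = ∑ j ∈ Finset.range n, pairInteraction (j * (π / n)) := by
  induction i with
  | zero =>
    refine Finset.sum_congr rfl fun j _ => ?_
    rw [← pairInteraction_neg]
    congr 1
    push_cast
    ring
  | succ i ih =>
    rw [← ih]
    have hn0 : (n : ℝ) ≠ 0 := by exact_mod_cast hn.ne'
    set g : ℕ → ℝ := fun j => pairInteraction ((((i + 1 : ℕ) : ℝ) - j) * (π / n)) with hg
    have hper : g n = g 0 := by
      simp only [hg]
      rw [← pairInteraction_sub_pi ((((i + 1 : ℕ) : ℝ) - (0 : ℕ)) * (π / n))]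
      congr 1
      push_cast
      field_simp
      ring
    have hshift : ∑ j ∈ Finset.range n, pairInteraction (((i : ℝ) - j) * (π / n))
        = ∑ j ∈ Finset.range n, g (j + 1) := by
      refine Finset.sum_congr rfl fun j _ => ?_
      simp only [hg]
      congr 1
      push_cast
      ring
    have h1 := Finset.sum_range_succ g n
    rw [Finset.sum_range_succ' g n] at h1
    linarith

theorem ringEnergy_eq {n : ℕ} (hn : 3 ≤ n) :
    ringEnergy n
      = -(n / 2) * sin (π / n) ^ 3 * ∑ k ∈ Finset.Ico 1 n, cscDD (k * (π / n)) := by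
  have hn3 : (3 : ℝ) ≤ n := by exact_mod_cast hn
  have hn0 : (0 : ℝ) < n := by linarith
  have hx0 : 0 < π / n := div_pos pi_pos hn0
  have hs : 0 < sin (π / n) := sin_pos_of_pos_of_lt_pi hx0 (div_lt_self pi_pos (by linarith))
  have hR : 0 < ringR n := by rw [ringR]; positivity
  have hterm : ∀ i j : ℕ, (if i = j then 0 else
        (3 * dot2 (ringPos n i - ringPos n j) (ringDip n j) *
            dot2 (ringPos n i - ringPos n j) (ringDip n i) -
          nrm2 (ringPos n i - ringPos n j) ^ 2 * dot2 (ringDip n i) (ringDip n j)) /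
        nrm2 (ringPos n i - ringPos n j) ^ 5)
      = 1 / (8 * ringR n ^ 3) * pairInteraction (((i : ℝ) - j) * (π / n)) := by
    intro i j
    split_ifs with h
    · simp [h, pairInteraction_zero]
    · have := dipole_term_eq (m := ((i : ℝ) + j) * (π / n)) (d := ((i : ℝ) - j) * (π / n)) hR
      have hi : ((i : ℝ) + j) * (π / n) + ((i : ℝ) - j) * (π / n) = 2 * π * i / n := by ring
      have hj : ((i : ℝ) + j) * (π / n) - ((i : ℝ) - j) * (π / n) = 2 * π * j / n := by ring
      rw [hi, hj] at this
      exact this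
  have hpos : ∑ k ∈ Finset.range n, pairInteraction (k * (π / n))
      = ∑ k ∈ Finset.Ico 1 n, cscDD (k * (π / n)) := by
    rw [Finset.range_eq_Ico, Finset.sum_eq_sum_Ico_succ_bot (by omega)]
    simp only [Nat.cast_zero, zero_mul, pairInteraction_zero, zero_add]
    refine Finset.sum_congr rfl fun k hk => ?_
    obtain ⟨hk1, hk2⟩ := Finset.mem_Ico.1 hk
    have hk1' : (0 : ℝ) < k := by exact_mod_cast hk1
    have hk2' : (k : ℝ) < n := by exact_mod_cast hk2
    rw [pairInteraction, cscDD, abs_of_pos]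
    refine sin_pos_of_pos_of_lt_pi (by positivity) ?_
    calc k * (π / n) < n * (π / n) := by gcongr
      _ = π := by field_simp
  rw [ringEnergy]
  simp only [hterm, ← Finset.mul_sum, sum_pairInteraction_sub (by omega : 0 < n), hpos,
    Finset.sum_const, Finset.card_range, nsmul_eq_mul]
  rw [ringR]
  field_simp
  ring

/-- The energy of a circular ring of `n` tangentially magnetized spheres satisfies
`Ē(n) = −2ζ(3)·n + (ζ(3) + 1/6)·π²·n⁻¹ + O(n⁻²)` as `n → ∞`. -/
theorem ring_energy_asymptotic :
    ∃ C : ℝ, 0 < C ∧ ∀ n : ℕ, 3 ≤ n →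
      |ringEnergy n + 2 * zeta3 * n - (zeta3 + 1 / 6) * π ^ 2 / n| ≤ C / (n : ℝ) ^ 2 := by
  obtain ⟨K, hK, hKb⟩ := exists_bound_sum_cscDD
  set f : ℝ × ℝ × ℝ → ℝ := fun p =>
    -(π / 2) * (p.2.2 * (1 - p.1 ^ 2 / 6 + p.2.1 * (p.1 ^ 2) ^ 2) ^ 3
      + p.1 * (1 / 6 + (3 * p.2.1 + 3 * (-1 / 6 + p.2.1 * p.1 ^ 2) ^ 2
        + p.1 ^ 2 * (-1 / 6 + p.2.1 * p.1 ^ 2) ^ 3) * (4 * zeta3 - p.1 ^ 2 / 3))) with hf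
  obtain ⟨M, hM, hMb⟩ := exists_pos_bound_of_continuous₃ (f := f) (by fun_prop) (K + 4)
  refine ⟨M * π ^ 2, by positivity, fun n hn => ?_⟩
  have hn3 : (3 : ℝ) ≤ n := by exact_mod_cast hn
  have hn0 : (0 : ℝ) < n := by linarith
  have hE := hKb n hn
  rw [ringEnergy_eq hn]
  set x : ℝ := π / n with hx
  have hx0 : 0 < x := div_pos pi_pos hn0
  have hxn : (n : ℝ) = π / x := by rw [hx]; field_simp
  have hx4 : x ≤ 4 := (div_le_self pi_pos.le (by linarith)).trans pi_le_four
  obtain ⟨α, hα, hs⟩ := exists_sin_eq_taylor hx0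
  set S := ∑ k ∈ Finset.Ico 1 n, cscDD (k * x)
  set E := S - (4 * zeta3 / x ^ 3 - 1 / (3 * x)) with hEdef
  have hS : S = E + (4 * zeta3 / x ^ 3 - 1 / (3 * x)) := by rw [hEdef]; ring
  have hb := hMb x α E (by rw [abs_of_pos hx0]; linarith) (by linarith) (by linarith)
  have key : -(n / 2) * sin x ^ 3 * S + 2 * zeta3 * n - (zeta3 + 1 / 6) * π ^ 2 / n
      = x ^ 2 * f (x, α, E) := by
    rw [hS, hs, hxn, hf]
    have := pi_pos
    field_simp
    ring
  rw [key, abs_mul, abs_of_pos (by positivity)]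
  calc x ^ 2 * |f (x, α, E)| ≤ x ^ 2 * M := by gcongr
    _ = M * π ^ 2 / (n : ℝ) ^ 2 := by rw [hx, div_pow]; ring
end

section
/- The energy per magnet of a circular ring of n tangentially magnetized spheres converges to −2ζ(3): lim_{n→∞} Ē(n)/n = −2ζ(3), where ζ(3) = Σ_{k≥1} 1/k³. -/
open Real Filter

/-- The pair interaction of two magnets of the ring of `n` magnets whose indices differ by `x`,
scaled by `n⁻³`. -/
noncomputable def ringPair (n : ℕ) (x : ℝ) : ℝ :=
  (1 + Real.cos (π * x / n) ^ 2) * |Real.sin (π / n) / Real.sin (π * x / n)| ^ 3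

lemma ringPair_zero (n : ℕ) : ringPair n 0 = 0 := by
  simp [ringPair]

lemma ringPair_neg (n : ℕ) (x : ℝ) : ringPair n (-x) = ringPair n x := by
  simp [ringPair, neg_div, div_neg]

lemma ringPair_add_self {n : ℕ} (hn : n ≠ 0) (x : ℝ) : ringPair n (x + n) = ringPair n x := by
  have h : π * (x + n) / n = π * x / n + π := by
    have : (n : ℝ) ≠ 0 := by exact_mod_cast hn
    field_simp
  simp [ringPair, h, Real.cos_add_pi, Real.sin_add_pi, div_neg]

lemma ringPair_nonneg (n : ℕ) (x : ℝ) : 0 ≤ ringPair n x := by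
  unfold ringPair
  positivity

/-- The dipole–dipole interaction of two magnets of the ring depends only on the difference of
their indices. -/
lemma dipole_term_eq_ringPair (n i j : ℕ) :
    (3 * dot2 (ringPos n i - ringPos n j) (ringDip n j) *
        dot2 (ringPos n i - ringPos n j) (ringDip n i) -
      nrm2 (ringPos n i - ringPos n j) ^ 2 * dot2 (ringDip n i) (ringDip n j)) /
      nrm2 (ringPos n i - ringPos n j) ^ 5 = (n : ℝ) ^ 3 * ringPair n ((j : ℝ) - i) := by
  set d : ℝ := π * ((j : ℝ) - i) / n with hd
  set β : ℝ := 2 * π * j / n with hβ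
  have hα : 2 * π * i / n = β - 2 * d := by rw [hd, hβ]; ring
  have hsq := Real.sin_sq_add_cos_sq d
  have hsqβ := Real.sin_sq_add_cos_sq β
  have hdist : dot2 (ringPos n i - ringPos n j) (ringPos n i - ringPos n j) =
      (2 * ringR n * Real.sin d) ^ 2 := by
    simp only [dot2, ringPos, Prod.fst_sub, Prod.snd_sub, hα, ← hβ, Real.cos_sub, Real.sin_sub,
      Real.cos_two_mul, Real.sin_two_mul]
    have hc : Real.cos d ^ 2 = 1 - Real.sin d ^ 2 := by linarith
    have hcβ : Real.cos β ^ 2 = 1 - Real.sin β ^ 2 := by linarith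
    rw [hc]
    ring_nf
    rw [hc, hcβ]
    ring
  have hj : dot2 (ringPos n i - ringPos n j) (ringDip n j) =
      -(2 * ringR n * Real.sin d * Real.cos d) := by
    simp only [dot2, ringPos, ringDip, Prod.fst_sub, Prod.snd_sub, hα, ← hβ, Real.cos_sub,
      Real.sin_sub, Real.sin_two_mul]
    linear_combination (-(2 * ringR n * Real.sin d * Real.cos d)) * hsqβ
  have hi : dot2 (ringPos n i - ringPos n j) (ringDip n i) =
      -(2 * ringR n * Real.sin d * Real.cos d) := by
    simp only [dot2, ringPos, ringDip, Prod.fst_sub, Prod.snd_sub, hα, ← hβ, Real.cos_sub,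
      Real.sin_sub, Real.sin_two_mul]
    linear_combination (-(2 * ringR n * Real.sin d * Real.cos d)) * hsqβ
  have hm : dot2 (ringDip n i) (ringDip n j) = Real.cos d ^ 2 - Real.sin d ^ 2 := by
    simp only [dot2, ringDip, hα, ← hβ, Real.cos_sub, Real.sin_sub, Real.cos_two_mul]
    linear_combination (2 * Real.cos d ^ 2 - 1) * hsqβ + hsq
  have hnrm : nrm2 (ringPos n i - ringPos n j) = |2 * ringR n * Real.sin d| := by
    rw [nrm2, hdist, Real.sqrt_sq_eq_abs]
  have hR : 2 * ringR n * Real.sin d = (n * (Real.sin (π / n) / Real.sin d))⁻¹ := by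
    rw [ringR]
    simp only [one_div, mul_inv, inv_div]
    ring
  rw [hj, hi, hm, hnrm, ringPair, ← hd]
  set t : ℝ := 2 * ringR n * Real.sin d with ht
  have hn : (n : ℝ) ^ 3 * ((1 + Real.cos d ^ 2) * |Real.sin (π / n) / Real.sin d| ^ 3) =
      (1 + Real.cos d ^ 2) * (|t| ^ 3)⁻¹ := by
    rw [hR, abs_inv, inv_pow, inv_inv, abs_mul, Nat.abs_cast]
    ring
  rw [hn]
  by_cases h0 : t = 0
  · simp [h0]
  · have h1 : |t| ≠ 0 := abs_ne_zero.mpr h0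
    have hnum : 3 * -(t * Real.cos d) * -(t * Real.cos d) -
        |t| ^ 2 * (Real.cos d ^ 2 - Real.sin d ^ 2) = |t| ^ 2 * (1 + Real.cos d ^ 2) := by
      linear_combination (-3 * Real.cos d ^ 2) * sq_abs t + |t| ^ 2 * hsq
    rw [hnum]
    field_simp

lemma Function.Periodic.sum_range_sub_natCast {f : ℝ → ℝ} {n : ℕ} (hf : Function.Periodic f n)
    (i : ℕ) : ∑ j ∈ Finset.range n, f ((j : ℝ) - i) = ∑ j ∈ Finset.range n, f j := by
  induction i with
  | zero => simp
  | succ i ih =>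
    rw [← ih]
    have h := Finset.sum_range_succ (fun j : ℕ => f ((j : ℝ) - (i + 1 : ℕ))) n
    rw [Finset.sum_range_succ'] at h
    have hn : f ((n : ℝ) - (i + 1 : ℕ)) = f (((0 : ℕ) : ℝ) - (i + 1 : ℕ)) := by
      rw [← hf (((0 : ℕ) : ℝ) - (i + 1 : ℕ))]
      congr 1
      push_cast
      ring
    rw [hn, add_left_inj] at h
    rw [← h]
    refine Finset.sum_congr rfl fun j _ => ?_
    congr 1
    push_cast
    ring

lemma ringEnergy_div_eq {n : ℕ} (hn : n ≠ 0) :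
    ringEnergy n / n = -(1 / 2) * ∑ k ∈ Finset.range (n - 1), ringPair n ((k + 1 : ℕ) : ℝ) := by
  have hterm : ∀ i ∈ Finset.range n, (∑ j ∈ Finset.range n,
      if i = j then 0 else
        (3 * dot2 (ringPos n i - ringPos n j) (ringDip n j) *
            dot2 (ringPos n i - ringPos n j) (ringDip n i) -
          nrm2 (ringPos n i - ringPos n j) ^ 2 * dot2 (ringDip n i) (ringDip n j)) /
        nrm2 (ringPos n i - ringPos n j) ^ 5) =
      (n : ℝ) ^ 3 * ∑ k ∈ Finset.range (n - 1), ringPair n ((k + 1 : ℕ) : ℝ) := by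
    intro i _
    have hshift : ∑ j ∈ Finset.range n, ringPair n ((j : ℝ) - i) =
        ∑ k ∈ Finset.range (n - 1), ringPair n ((k + 1 : ℕ) : ℝ) := by
      rw [Function.Periodic.sum_range_sub_natCast (ringPair_add_self hn)]
      obtain ⟨m, rfl⟩ := Nat.exists_eq_succ_of_ne_zero hn
      rw [Nat.succ_eq_add_one, Finset.sum_range_succ']
      simp [ringPair_zero]
    rw [← hshift, Finset.mul_sum]
    refine Finset.sum_congr rfl fun j _ => ?_
    split_ifs with h
    · simp [h, ringPair_zero]
    · exact dipole_term_eq_ringPair n i j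
  have hn' : (n : ℝ) ≠ 0 := by exact_mod_cast hn
  rw [ringEnergy, Finset.sum_congr rfl hterm, Finset.sum_const, Finset.card_range, nsmul_eq_mul]
  field_simp

/-- The cutoff to the half ring `2 m ≤ n`, giving half weight to the antipode. -/
noncomputable def halfWeight (n m : ℕ) : ℝ :=
  if 2 * m < n then 1 else if 2 * m = n then 1 / 2 else 0

lemma halfWeight_add_sub {n m : ℕ} (h : m ≤ n) : halfWeight n m + halfWeight n (n - m) = 1 := by
  unfold halfWeight
  split_ifs <;> first | omega | norm_num

lemma sum_ringPair_eq_tsum {n : ℕ} (hn : n ≠ 0) :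
    ∑ k ∈ Finset.range (n - 1), ringPair n ((k + 1 : ℕ) : ℝ) =
      2 * ∑' k : ℕ, halfWeight n (k + 1) * ringPair n ((k + 1 : ℕ) : ℝ) := by
  have hsupp : ∑' k : ℕ, halfWeight n (k + 1) * ringPair n ((k + 1 : ℕ) : ℝ) =
      ∑ k ∈ Finset.range (n - 1), halfWeight n (k + 1) * ringPair n ((k + 1 : ℕ) : ℝ) := by
    refine tsum_eq_sum fun k hk => ?_
    have hk' : n - 1 ≤ k := by simpa using hk
    rw [halfWeight, if_neg (by omega), if_neg (by omega), zero_mul]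
  have hreflect :
      ∑ k ∈ Finset.range (n - 1), halfWeight n (n - (k + 1)) * ringPair n ((k + 1 : ℕ) : ℝ) =
      ∑ k ∈ Finset.range (n - 1), halfWeight n (k + 1) * ringPair n ((k + 1 : ℕ) : ℝ) := by
    rw [← Finset.sum_range_reflect
      (fun k => halfWeight n (k + 1) * ringPair n ((k + 1 : ℕ) : ℝ)) (n - 1)]
    refine Finset.sum_congr rfl fun k hk => ?_
    have hk' : k < n - 1 := by simpa using hk
    have hidx : n - 1 - 1 - k + 1 = n - (k + 1) := by omega
    have hle : k + 1 ≤ n := by omega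
    rw [hidx, Nat.cast_sub hle, ← ringPair_neg, ← ringPair_add_self hn, neg_add_eq_sub]
  rw [hsupp, two_mul]
  nth_rewrite 1 [← hreflect]
  rw [← Finset.sum_add_distrib]
  refine Finset.sum_congr rfl fun k hk => ?_
  have hk' : k < n - 1 := by simpa using hk
  have hw := halfWeight_add_sub (show k + 1 ≤ n by omega)
  linear_combination (-ringPair n ((k + 1 : ℕ) : ℝ)) * hw

lemma ringPair_le {n m : ℕ} (hm : 0 < m) (h : 2 * m ≤ n) :
    ringPair n m ≤ 16 * (1 / (m : ℝ) ^ 3) := by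
  have hm0 : (0 : ℝ) < m := by exact_mod_cast hm
  have hn0 : (0 : ℝ) < n := by exact_mod_cast (show 0 < n by omega)
  have h' : 2 * (m : ℝ) ≤ n := by exact_mod_cast h
  have hlow : 2 * (m : ℝ) / n ≤ Real.sin (π * m / n) := by
    have hle : π * m / n ≤ π / 2 := by
      rw [div_le_div_iff₀ hn0 two_pos]
      nlinarith [Real.pi_pos]
    refine le_trans (le_of_eq ?_) (Real.mul_le_sin (by positivity) hle)
    have := Real.pi_ne_zero
    field_simp
  have hsin0 : 0 ≤ Real.sin (π / n) := by
    refine Real.sin_nonneg_of_nonneg_of_le_pi (by positivity) (div_le_self Real.pi_pos.le ?_)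
    exact_mod_cast (show 1 ≤ n by omega)
  have hpos : 0 < 2 * (m : ℝ) / n := by positivity
  have hup : Real.sin (π / n) ≤ 4 / n :=
    (Real.sin_le (by positivity)).trans (by gcongr; exact Real.pi_le_four)
  have hratio : |Real.sin (π / n) / Real.sin (π * m / n)| ≤ 2 / m := by
    rw [abs_of_nonneg (div_nonneg hsin0 (hpos.le.trans hlow))]
    calc Real.sin (π / n) / Real.sin (π * m / n) ≤ (4 / n) / (2 * m / n) := by gcongr
      _ = 2 / m := by field_simp; norm_num
  calc ringPair n m ≤ 2 * (2 / (m : ℝ)) ^ 3 := by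
        unfold ringPair
        gcongr
        linarith [Real.cos_sq_le_one (π * m / n)]
    _ = 16 * (1 / (m : ℝ) ^ 3) := by rw [div_pow]; ring

lemma norm_halfWeight_mul_ringPair_le (n k : ℕ) :
    ‖halfWeight n (k + 1) * ringPair n ((k + 1 : ℕ) : ℝ)‖ ≤ 16 * (1 / ((k : ℝ) + 1) ^ 3) := by
  have hw0 : 0 ≤ halfWeight n (k + 1) := by unfold halfWeight; split_ifs <;> norm_num
  have hw1 : halfWeight n (k + 1) ≤ 1 := by unfold halfWeight; split_ifs <;> norm_num
  have hp := ringPair_nonneg n ((k + 1 : ℕ) : ℝ)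
  rw [Real.norm_of_nonneg (mul_nonneg hw0 hp)]
  by_cases h : 2 * (k + 1) ≤ n
  · have := ringPair_le k.succ_pos h
    push_cast at this hp ⊢
    exact (mul_le_of_le_one_left hp hw1).trans this
  · rw [halfWeight, if_neg (by omega), if_neg (by omega), zero_mul]
    positivity

lemma tendsto_natCast_mul_sin_div {c : ℝ} (hc : c ≠ 0) :
    Tendsto (fun n : ℕ => (n : ℝ) * Real.sin (c / n)) atTop (nhds c) := by
  have h : Tendsto (fun n : ℕ => c * Real.sinc (c / n)) atTop (nhds (c * Real.sinc 0)) :=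
    ((Real.continuous_sinc.tendsto 0).comp (tendsto_const_div_atTop_nhds_zero_nat c)).const_mul c
  rw [Real.sinc_zero, mul_one] at h
  refine h.congr' ?_
  filter_upwards [eventually_ne_atTop 0] with n hn
  have hn' : (n : ℝ) ≠ 0 := by exact_mod_cast hn
  rw [Real.sinc_of_ne_zero (div_ne_zero hc hn')]
  field_simp

lemma tendsto_ringPair {x : ℝ} (hx : 0 < x) :
    Tendsto (fun n : ℕ => ringPair n x) atTop (nhds (2 * (1 / x ^ 3))) := by
  have hcos : Tendsto (fun n : ℕ => Real.cos (π * x / n)) atTop (nhds (Real.cos 0)) :=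
    (Real.continuous_cos.tendsto 0).comp (tendsto_const_div_atTop_nhds_zero_nat _)
  have hπx : π * x ≠ 0 := mul_ne_zero Real.pi_ne_zero hx.ne'
  have hratio : Tendsto (fun n : ℕ => Real.sin (π / n) / Real.sin (π * x / n)) atTop
      (nhds (π / (π * x))) := by
    refine ((tendsto_natCast_mul_sin_div Real.pi_ne_zero).div
      (tendsto_natCast_mul_sin_div hπx) hπx).congr' ?_
    filter_upwards [eventually_ne_atTop 0] with n hn
    exact mul_div_mul_left _ _ (by exact_mod_cast hn)
  have h := ((hcos.pow 2).const_add 1).mul (hratio.abs.pow 3)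
  have hlim : (1 + Real.cos 0 ^ 2) * |π / (π * x)| ^ 3 = 2 * (1 / x ^ 3) := by
    have hq : π / (π * x) = 1 / x := by
      have := Real.pi_ne_zero
      field_simp
    rw [hq, abs_of_pos (by positivity), Real.cos_zero, div_pow]
    norm_num
  rw [hlim] at h
  exact h

lemma tendsto_halfWeight_mul_ringPair (k : ℕ) :
    Tendsto (fun n : ℕ => halfWeight n (k + 1) * ringPair n ((k + 1 : ℕ) : ℝ)) atTop
      (nhds (2 * (1 / ((k : ℝ) + 1) ^ 3))) := by
  have h := tendsto_ringPair (x := ((k + 1 : ℕ) : ℝ)) (by positivity)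
  rw [Nat.cast_add_one] at h ⊢
  refine h.congr' ?_
  filter_upwards [eventually_gt_atTop (2 * (k + 1))] with n hn
  rw [halfWeight, if_pos hn, one_mul]

/-- The energy per magnet of a circular ring of `n` tangentially magnetized spheres
converges to `−2ζ(3)`. -/
theorem ring_energy_per_magnet_limit :
    Tendsto (fun n : ℕ => ringEnergy n / n) atTop (nhds (-2 * zeta3)) := by
  have hsum : Summable fun k : ℕ => 1 / ((k : ℝ) + 1) ^ 3 := by
    have := (summable_nat_add_iff 1).mpr
      (Real.summable_one_div_nat_pow.mpr (show 1 < 3 by norm_num))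
    simpa using this
  have h := tendsto_tsum_of_dominated_convergence (hsum.mul_left 16)
    tendsto_halfWeight_mul_ringPair
    (Eventually.of_forall fun n k => norm_halfWeight_mul_ringPair_le n k)
  rw [tsum_mul_left] at h
  have hlim : -1 * (2 * ∑' k : ℕ, 1 / ((k : ℝ) + 1) ^ 3) = -2 * zeta3 := by
    rw [zeta3]
    ring
  rw [← hlim]
  refine (h.const_mul (-1)).congr' ?_
  filter_upwards [eventually_ne_atTop 0] with n hn
  rw [ringEnergy_div_eq hn, sum_ringPair_eq_tsum hn]
  ring
end

section
/- For every integer n ≥ 3, the dimensionless energy of the circular ring of n tangentially magnetized spheres has the closed form Ē(n) = −(n·sin³(π/n)/2) · Σ_{k=1}^{n−1} (1 + cos²(πk/n)) / sin³(πk/n). -/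
open Real Filter

/-- The dipole interaction profile `(1 + cos² x) / |sin x|³`. -/
noncomputable def dipoleProfile (x : ℝ) : ℝ := (1 + Real.cos x ^ 2) / |Real.sin x| ^ 3

lemma dipoleProfile_periodic : Function.Periodic dipoleProfile π := fun x => by
  simp [dipoleProfile, Real.sin_add_pi, Real.cos_add_pi]

lemma sum_range_sub_of_periodic {M : Type*} [AddCommGroup M] {g : ℝ → M} {n : ℕ}
    (hg : Function.Periodic g n) (j : ℕ) :
    ∑ i ∈ Finset.range n, g ((i : ℝ) - j) = ∑ i ∈ Finset.range n, g i := by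
  induction j with
  | zero => simp
  | succ j ih =>
    rw [← ih]
    have h₁ := Finset.sum_range_succ (fun i : ℕ => g ((i : ℝ) - (j + 1 : ℕ))) n
    rw [Finset.sum_range_succ'] at h₁
    have h₂ : g ((n : ℝ) - (j + 1 : ℕ)) = g (((0 : ℕ) : ℝ) - (j + 1 : ℕ)) := by
      rw [← hg (((0 : ℕ) : ℝ) - (j + 1 : ℕ))]
      congr 1
      push_cast
      ring
    rw [h₂] at h₁
    rw [← add_right_cancel h₁]
    refine Finset.sum_congr rfl fun i _ => ?_
    congr 1
    push_cast
    ring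

lemma dot2_sub_ringDip_right (n i j : ℕ) :
    dot2 (ringPos n i - ringPos n j) (ringDip n j) =
      ringR n * Real.sin (2 * (π * (i - j) / n)) := by
  rw [show 2 * (π * ((i : ℝ) - j) / n) = 2 * π * i / n - 2 * π * j / n by ring, Real.sin_sub]
  simp only [dot2, ringPos, ringDip, Prod.fst_sub, Prod.snd_sub]
  ring

lemma dot2_sub_ringDip_left (n i j : ℕ) :
    dot2 (ringPos n i - ringPos n j) (ringDip n i) =
      ringR n * Real.sin (2 * (π * (i - j) / n)) := by
  rw [show 2 * (π * ((i : ℝ) - j) / n) = 2 * π * i / n - 2 * π * j / n by ring, Real.sin_sub]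
  simp only [dot2, ringPos, ringDip, Prod.fst_sub, Prod.snd_sub]
  ring

lemma dot2_ringDip (n i j : ℕ) :
    dot2 (ringDip n i) (ringDip n j) = Real.cos (2 * (π * (i - j) / n)) := by
  rw [show 2 * (π * ((i : ℝ) - j) / n) = 2 * π * i / n - 2 * π * j / n by ring, Real.cos_sub]
  simp only [dot2, ringDip]
  ring

lemma nrm2_ringPos_sub (n i j : ℕ) :
    nrm2 (ringPos n i - ringPos n j) = |2 * ringR n * Real.sin (π * (i - j) / n)| := by
  rw [nrm2, ← Real.sqrt_sq_eq_abs]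
  congr 1
  have h : Real.cos (2 * π * i / n - 2 * π * j / n) =
      1 - 2 * Real.sin (π * (i - j) / n) ^ 2 := by
    rw [show 2 * π * i / n - 2 * π * j / n = 2 * (π * ((i : ℝ) - j) / n) by ring,
      Real.cos_two_mul, Real.cos_sq']
    ring
  rw [Real.cos_sub] at h
  simp only [dot2, ringPos, Prod.fst_sub, Prod.snd_sub]
  linear_combination ringR n ^ 2 * (Real.sin_sq_add_cos_sq (2 * π * i / n) +
    Real.sin_sq_add_cos_sq (2 * π * j / n) - 2 * h)

lemma sin_pi_div_pos {n : ℕ} (hn : 2 ≤ n) : 0 < Real.sin (π / n) := by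
  have hn' : (1 : ℝ) < n := by exact_mod_cast hn
  exact Real.sin_pos_of_pos_of_lt_pi (by positivity) (div_lt_self Real.pi_pos hn')

lemma ring_pair_energy {n : ℕ} (hn : 2 ≤ n) (i j : ℕ) :
    (3 * dot2 (ringPos n i - ringPos n j) (ringDip n j) *
          dot2 (ringPos n i - ringPos n j) (ringDip n i) -
        nrm2 (ringPos n i - ringPos n j) ^ 2 * dot2 (ringDip n i) (ringDip n j)) /
      nrm2 (ringPos n i - ringPos n j) ^ 5 =
    (n : ℝ) ^ 3 * Real.sin (π / n) ^ 3 * dipoleProfile (π * (i - j) / n) := by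
  have hS := sin_pi_div_pos hn
  have hn₀ : (0 : ℝ) < n := by exact_mod_cast (by omega : 0 < n)
  have hR : 0 < ringR n := by unfold ringR; positivity
  have hRS : 2 * ringR n * (n * Real.sin (π / n)) = 1 := by
    unfold ringR
    field_simp
  rw [dot2_sub_ringDip_right, dot2_sub_ringDip_left, dot2_ringDip, nrm2_ringPos_sub,
    dipoleProfile, Real.sin_two_mul, Real.cos_two_mul, abs_mul, abs_of_pos (by positivity),
    ← mul_pow, eq_one_div_of_mul_eq_one_right hRS]
  generalize π * ((i : ℝ) - j) / n = x
  rcases eq_or_ne (Real.sin x) 0 with hx | hx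
  · simp [hx]
  · have hx' : 0 < |Real.sin x| := abs_pos.mpr hx
    have hsq := sq_abs (Real.sin x)
    rw [div_eq_iff (by positivity)]
    field_simp
    rw [← hsq]
    ring

lemma sum_range_dipoleProfile (n : ℕ) :
    ∑ i ∈ Finset.range n, dipoleProfile (π * i / n) =
      ∑ k ∈ Finset.Icc 1 (n - 1),
        (1 + Real.cos (π * k / n) ^ 2) / Real.sin (π * k / n) ^ 3 := by
  rcases n with _ | m
  · simp
  rw [Finset.range_eq_Ico, Finset.sum_eq_sum_Ico_succ_bot m.succ_pos]
  have h₀ : dipoleProfile (π * (0 : ℕ) / (m + 1 : ℕ)) = 0 := by simp [dipoleProfile]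
  rw [h₀, zero_add]
  refine Finset.sum_congr rfl fun k hk => ?_
  have hk' := Finset.mem_Icc.mp hk
  have hkm : (k : ℝ) ≤ (m + 1 : ℕ) := by exact_mod_cast (by omega : k ≤ m + 1)
  rw [dipoleProfile, abs_of_nonneg]
  refine Real.sin_nonneg_of_nonneg_of_le_pi (by positivity) ?_
  rw [div_le_iff₀ (by positivity)]
  gcongr

/-- Closed form for the dimensionless energy of the circular ring:
`Ē(n) = −(n sin³(π/n)/2) Σ_{k=1}^{n−1} (1 + cos²(πk/n))/sin³(πk/n)`. -/
theorem ring_energy_closed_form :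
    ∀ n : ℕ, 3 ≤ n →
      ringEnergy n =
        -((n : ℝ) * Real.sin (π / n) ^ 3 / 2) *
          ∑ k ∈ Finset.Icc 1 (n - 1),
            (1 + Real.cos (π * k / n) ^ 2) / Real.sin (π * k / n) ^ 3 := by
  intro n hn
  have hn₀ : (n : ℝ) ≠ 0 := by exact_mod_cast (by omega : n ≠ 0)
  have hper : Function.Periodic (fun x : ℝ => dipoleProfile (π * x / n)) n := fun x => by
    simp only [mul_add, add_div, mul_div_cancel_right₀ _ hn₀]
    exact dipoleProfile_periodic _
  have hterm (i j : ℕ) : (if i = j then 0 else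
        (3 * dot2 (ringPos n i - ringPos n j) (ringDip n j) *
            dot2 (ringPos n i - ringPos n j) (ringDip n i) -
          nrm2 (ringPos n i - ringPos n j) ^ 2 * dot2 (ringDip n i) (ringDip n j)) /
        nrm2 (ringPos n i - ringPos n j) ^ 5) =
      (n : ℝ) ^ 3 * Real.sin (π / n) ^ 3 * dipoleProfile (π * (i - j) / n) := by
    split_ifs with h
    · simp [h, dipoleProfile]
    · exact ring_pair_energy (by omega) i j
  simp only [ringEnergy, hterm]
  rw [Finset.sum_comm]
  simp only [← Finset.mul_sum, sum_range_sub_of_periodic hper, sum_range_dipoleProfile,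
    Finset.sum_const, Finset.card_range, nsmul_eq_mul]
  field_simp
end

section
/- Let a > 0 and R ∈ ℝ³ with ‖R‖ > a, and let m, m₀ ∈ ℝ³. Then the volume integral of the dipole interaction kernel over the ball of radius a centred at R satisfies ∫_{x ∈ B(R,a)} (3⟨m, x⟩⟨m₀, x⟩ − ‖x‖²⟨m, m₀⟩)/‖x‖⁵ dx = (4πa³/3) · (3⟨m, R⟩⟨m₀, R⟩ − ‖R‖²⟨m, m₀⟩)/‖R‖⁵. (Consequently, the interaction energy of a uniformly magnetized sphere with a point dipole equals the interaction energy of two point dipoles.) -/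
open Real MeasureTheory
open scoped RealInnerProductSpace

theorem integral_quadratic_cos_sin (A B C D E F : ℝ) :
    ∫ t in Set.Ioo (-π) π,
        (A + B * cos t + C * sin t + D * cos t ^ 2 + E * sin t ^ 2 + F * (sin t * cos t)) =
      π * (2 * A + D + E) := by
  rw [← integral_Ioc_eq_integral_Ioo,
    ← intervalIntegral.integral_of_le (by linarith [pi_pos])]
  have key : ∀ t ∈ Set.uIcc (-π) π, HasDerivAt
      (fun t => A * t + B * sin t - C * cos t + D * ((t + sin t * cos t) / 2) +
        E * ((t - sin t * cos t) / 2) + F * (sin t ^ 2 / 2))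
      (A + B * cos t + C * sin t + D * cos t ^ 2 + E * sin t ^ 2 + F * (sin t * cos t)) t := by
    intro t _
    have hs := hasDerivAt_sin t
    have hc := hasDerivAt_cos t
    have hi := hasDerivAt_id' t
    have hsc := hs.mul hc
    have := (((((hi.const_mul A).add (hs.const_mul B)).sub (hc.const_mul C)).add
      (((hi.add hsc).div_const 2).const_mul D)).add
      (((hi.sub hsc).div_const 2).const_mul E)).add (((hs.pow 2).div_const 2).const_mul F)
    refine this.congr_deriv ?_
    have h1 := sin_sq_add_cos_sq t
    push_cast
    linear_combination (-D / 2 - E / 2) * h1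
  rw [intervalIntegral.integral_eq_sub_of_hasDerivAt key
    (Continuous.intervalIntegrable (by fun_prop) _ _)]
  simp
  ring

theorem integral_radial_dipole {z S : ℝ} (hz : 0 < z) (hS : 0 ≤ S) :
    ∫ s in Set.Ioo 0 S, s * (2 * z ^ 2 - s ^ 2) / √(z ^ 2 + s ^ 2) ^ 5 =
      S ^ 2 / √(z ^ 2 + S ^ 2) ^ 3 := by
  rw [← integral_Ioc_eq_integral_Ioo, ← intervalIntegral.integral_of_le hS]
  have hpos : ∀ s : ℝ, 0 < √(z ^ 2 + s ^ 2) := fun s => by positivity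
  have key : ∀ s ∈ Set.uIcc 0 S, HasDerivAt (fun s => s ^ 2 / √(z ^ 2 + s ^ 2) ^ 3)
      (s * (2 * z ^ 2 - s ^ 2) / √(z ^ 2 + s ^ 2) ^ 5) s := by
    intro s _
    have h0 : z ^ 2 + s ^ 2 ≠ 0 := by positivity
    have h1 := ((hasDerivAt_pow 2 s).const_add (z ^ 2)).sqrt h0
    have h2 := (hasDerivAt_pow 2 s).div (h1.fun_pow 3) (pow_ne_zero 3 (hpos s).ne')
    refine h2.congr_deriv ?_
    have hne := (hpos s).ne'
    have hsq : √(z ^ 2 + s ^ 2) ^ 2 = z ^ 2 + s ^ 2 := sq_sqrt (by positivity)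
    set u := √(z ^ 2 + s ^ 2)
    have : z ^ 2 = u ^ 2 - s ^ 2 := by linarith
    rw [this]
    field_simp
    push_cast
    ring
  rw [intervalIntegral.integral_eq_sub_of_hasDerivAt key]
  · simp
  · apply Continuous.intervalIntegrable
    exact Continuous.div (by fun_prop) (by fun_prop) fun s => pow_ne_zero 5 (hpos s).ne'

theorem integral_axial_dipole {a r : ℝ} (ha : 0 < a) (hr : a < r) :
    ∫ z in Set.Ioo (r - a) (r + a),
        (a ^ 2 - (z - r) ^ 2) / √(z ^ 2 + (a ^ 2 - (z - r) ^ 2)) ^ 3 =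
      4 * a ^ 3 / (3 * r ^ 3) := by
  rw [← integral_Ioc_eq_integral_Ioo, ← intervalIntegral.integral_of_le (by linarith)]
  have hr0 : 0 < r := ha.trans hr
  have hpos : ∀ z ∈ Set.uIcc (r - a) (r + a), 0 < z ^ 2 + (a ^ 2 - (z - r) ^ 2) := by
    intro z hz
    rw [Set.uIcc_of_le (by linarith)] at hz
    nlinarith [hz.1, mul_le_mul_of_nonneg_left hz.1 hr0.le, mul_pos (sub_pos.2 hr) (sub_pos.2 hr)]
  have key : ∀ z ∈ Set.uIcc (r - a) (r + a), HasDerivAt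
      (fun z => (-√(z ^ 2 + (a ^ 2 - (z - r) ^ 2)) ^ 3 / 3 +
        2 * (r ^ 2 + a ^ 2) * √(z ^ 2 + (a ^ 2 - (z - r) ^ 2)) +
        (r ^ 2 - a ^ 2) ^ 2 / √(z ^ 2 + (a ^ 2 - (z - r) ^ 2))) / (4 * r ^ 3))
      ((a ^ 2 - (z - r) ^ 2) / √(z ^ 2 + (a ^ 2 - (z - r) ^ 2)) ^ 3) z := by
    intro z hz
    have h0 := hpos z hz
    have hne := (sqrt_pos.2 h0).ne'
    have h1 := (((hasDerivAt_pow 2 z).fun_add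
      ((((hasDerivAt_id' z).sub_const r).fun_pow 2).const_sub (a ^ 2)))).sqrt h0.ne'
    have h2 := (((((h1.fun_pow 3).neg.div_const 3).add (h1.const_mul (2 * (r ^ 2 + a ^ 2)))).add
      ((hasDerivAt_const z ((r ^ 2 - a ^ 2) ^ 2)).div h1 hne))).div_const (4 * r ^ 3)
    refine h2.congr_deriv ?_
    have hsq := sq_sqrt h0.le
    set u := √(z ^ 2 + (a ^ 2 - (z - r) ^ 2))
    have hzu : z = (u ^ 2 + r ^ 2 - a ^ 2) / (2 * r) := by
      field_simp
      linarith
    clear_value u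
    subst hzu
    simp only [Nat.cast_ofNat, Nat.reduceSub, pow_one]
    field_simp
    ring
  rw [intervalIntegral.integral_eq_sub_of_hasDerivAt key]
  · have e1 : (r + a) ^ 2 + (a ^ 2 - (r + a - r) ^ 2) = (r + a) ^ 2 := by ring
    have e2 : (r - a) ^ 2 + (a ^ 2 - (r - a - r) ^ 2) = (r - a) ^ 2 := by ring
    have h3 : r - a ≠ 0 := (sub_pos.2 hr).ne'
    rw [e1, e2, sqrt_sq (by linarith), sqrt_sq (by linarith)]
    field_simp
    ring
  · apply ContinuousOn.intervalIntegrable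
    exact ContinuousOn.div (by fun_prop) (by fun_prop)
      fun z hz => pow_ne_zero 3 (sqrt_pos.2 (hpos z hz)).ne'

theorem integral_disc_dipole {z S : ℝ} (hz : 0 < z) (hS : 0 ≤ S) (α β γ α' β' γ' : ℝ) :
    ∫ p in {p : ℝ × ℝ | p.1 ^ 2 + p.2 ^ 2 < S ^ 2},
        (3 * (α * z + β * p.1 + γ * p.2) * (α' * z + β' * p.1 + γ' * p.2) -
          (z ^ 2 + p.1 ^ 2 + p.2 ^ 2) * (α * α' + β * β' + γ * γ')) /
          √(z ^ 2 + p.1 ^ 2 + p.2 ^ 2) ^ 5 =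
      π * (2 * (α * α') - β * β' - γ * γ') * (S ^ 2 / √(z ^ 2 + S ^ 2) ^ 3) := by
  have hmeas : MeasurableSet {p : ℝ × ℝ | p.1 ^ 2 + p.2 ^ 2 < S ^ 2} :=
    measurableSet_lt (by fun_prop) (by fun_prop)
  set g : ℝ × ℝ → ℝ := fun q => q.1 *
      ((3 * (α * z + β * (q.1 * cos q.2) + γ * (q.1 * sin q.2)) *
        (α' * z + β' * (q.1 * cos q.2) + γ' * (q.1 * sin q.2)) -
          (z ^ 2 + q.1 ^ 2) * (α * α' + β * β' + γ * γ')) / √(z ^ 2 + q.1 ^ 2) ^ 5) with hg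
  have hcs : ∀ s t : ℝ, (s * cos t) ^ 2 + (s * sin t) ^ 2 = s ^ 2 := fun s t => by
    linear_combination s ^ 2 * sin_sq_add_cos_sq t
  have hgint : IntegrableOn g (Set.Ioo 0 S ×ˢ Set.Ioo (-π) π) (volume.prod volume) := by
    have hc : Continuous g := by
      refine continuous_fst.mul (Continuous.div (by fun_prop) (by fun_prop) fun q => ?_)
      positivity
    exact (hc.continuousOn.integrableOn_compact (isCompact_Icc.prod isCompact_Icc)).mono_set
      (Set.prod_mono Set.Ioo_subset_Icc_self Set.Ioo_subset_Icc_self)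
  rw [← integral_indicator hmeas, ← integral_comp_polarCoord_symm, polarCoord_target]
  calc _ = ∫ q in Set.Ioi 0 ×ˢ Set.Ioo (-π) π, (Set.Iio S ×ˢ Set.univ).indicator g q := by
        refine setIntegral_congr_fun (measurableSet_Ioi.prod measurableSet_Ioo) fun q hq => ?_
        have hq0 : 0 < q.1 := hq.1
        have hiff : q.1 ^ 2 < S ^ 2 ↔ q.1 < S := by
          rw [sq_lt_sq₀ hq0.le hS]
        by_cases h : q.1 < S
        · simp [Set.indicator, hcs, hiff, h, hg, add_assoc]
        · simp [Set.indicator, hcs, hiff, h]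
    _ = ∫ q in Set.Ioo 0 S ×ˢ Set.Ioo (-π) π, g q ∂(volume.prod volume) := by
        rw [setIntegral_indicator (measurableSet_Iio.prod MeasurableSet.univ), Set.prod_inter_prod,
          Set.Ioi_inter_Iio, Set.inter_univ, ← Measure.volume_eq_prod]
    _ = ∫ s in Set.Ioo 0 S, π * (2 * (α * α') - β * β' - γ * γ') *
          (s * (2 * z ^ 2 - s ^ 2) / √(z ^ 2 + s ^ 2) ^ 5) := by
        rw [setIntegral_prod _ hgint]
        refine setIntegral_congr_fun measurableSet_Ioo fun s _ => ?_
        set u := s / √(z ^ 2 + s ^ 2) ^ 5 with hu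
        have := integral_quadratic_cos_sin
          (u * (3 * α * α' * z ^ 2 - (z ^ 2 + s ^ 2) * (α * α' + β * β' + γ * γ')))
          (u * 3 * s * z * (α * β' + α' * β)) (u * 3 * s * z * (α * γ' + α' * γ))
          (u * 3 * s ^ 2 * (β * β')) (u * 3 * s ^ 2 * (γ * γ'))
          (u * 3 * s ^ 2 * (β * γ' + γ * β'))
        calc _ = _ := integral_congr_ae (.of_forall fun t => by simp only [hg, hu]; ring)
          _ = _ := this
          _ = _ := by simp only [hu]; ring
    _ = _ := by rw [integral_const_mul, integral_radial_dipole hz hS]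

theorem OrthonormalBasis.measurePreserving_sum_three {E : Type*} [NormedAddCommGroup E]
    [InnerProductSpace ℝ E] [FiniteDimensional ℝ E] [MeasurableSpace E] [BorelSpace E]
    (b : OrthonormalBasis (Fin 3) ℝ E) :
    ∃ e : ℝ × ℝ × ℝ ≃ᵐ E, MeasurePreserving e volume volume ∧
      ∀ p, e p = p.1 • b 0 + p.2.1 • b 1 + p.2.2 • b 2 := by
  let e₁ : (Fin 3 → ℝ) ≃ᵐ ℝ × (Fin 2 → ℝ) := MeasurableEquiv.piFinSuccAbove (fun _ => ℝ) 0
  let e₂ : ℝ × (Fin 2 → ℝ) ≃ᵐ ℝ × ℝ × ℝ :=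
    (MeasurableEquiv.refl ℝ).prodCongr MeasurableEquiv.finTwoArrow
  let e₃ : (Fin 3 → ℝ) ≃ᵐ EuclideanSpace ℝ (Fin 3) := MeasurableEquiv.toLp 2 _
  let e₄ : EuclideanSpace ℝ (Fin 3) ≃ᵐ E := b.repr.symm.toHomeomorph.toMeasurableEquiv
  have h₁ : MeasurePreserving e₁ volume volume := volume_preserving_piFinSuccAbove _ 0
  have h₂ : MeasurePreserving e₂ volume volume :=
    (MeasurePreserving.id volume).prod (volume_preserving_finTwoArrow ℝ)
  have h₃ : MeasurePreserving e₃ volume volume := PiLp.volume_preserving_toLp _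
  have h₄ : MeasurePreserving e₄ volume volume := b.measurePreserving_repr_symm
  refine ⟨((e₁.trans e₂).symm.trans e₃).trans e₄,
    h₄.comp (h₃.comp ((h₁.trans h₂).symm _)), fun p => ?_⟩
  have : (e₁.trans e₂).symm p = ![p.1, p.2.1, p.2.2] := by
    rw [MeasurableEquiv.symm_apply_eq]
    rfl
  change b.repr.symm (WithLp.toLp 2 ((e₁.trans e₂).symm p)) = _
  rw [this, ← b.sum_repr_symm]
  simp [Fin.sum_univ_three]

theorem exists_orthonormalBasis_smul_zero_eq (R : EuclideanSpace ℝ (Fin 3)) (hR : R ≠ 0) :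
    ∃ b : OrthonormalBasis (Fin 3) ℝ (EuclideanSpace ℝ (Fin 3)), R = ‖R‖ • b 0 := by
  have hn : ‖R‖ ≠ 0 := norm_ne_zero_iff.2 hR
  have ho : Orthonormal ℝ (Set.domRestrict ({0} : Set (Fin 3)) fun _ => (‖R‖⁻¹ • R)) := by
    constructor
    · intro i
      simp [Set.domRestrict, norm_smul, hn]
    · intro i j hij
      exact absurd (Subsingleton.elim i j) hij
  obtain ⟨b, hb⟩ := ho.exists_orthonormalBasis_extension_of_card_eq (by simp)
  exact ⟨b, by rw [hb 0 rfl, smul_inv_smul₀ hn]⟩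

/-- The volume integral of the dipole interaction kernel over a ball `B(R, a)` with
`‖R‖ > a` equals `(4πa³/3)` times the point-dipole interaction kernel at `R`:
a uniformly magnetized sphere interacts with a point dipole exactly as two point
dipoles do. -/
theorem sphere_dipole_equivalence (a : ℝ) (ha : 0 < a)
    (R m m₀ : EuclideanSpace ℝ (Fin 3)) (hR : a < ‖R‖) :
    ∫ x in Metric.ball R a,
        (3 * ⟪m, x⟫ * ⟪m₀, x⟫ - ‖x‖ ^ 2 * ⟪m, m₀⟫) / ‖x‖ ^ 5 ∂volume =
      (4 * π * a ^ 3 / 3) *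
        ((3 * ⟪m, R⟫ * ⟪m₀, R⟫ - ‖R‖ ^ 2 * ⟪m, m₀⟫) / ‖R‖ ^ 5) := by
  obtain ⟨b, hb⟩ := exists_orthonormalBasis_smul_zero_eq R (norm_pos_iff.1 (ha.trans hR))
  obtain ⟨e, he, hep⟩ := b.measurePreserving_sum_three
  set r := ‖R‖ with hr
  have hr0 : 0 < r := ha.trans hR
  set f : EuclideanSpace ℝ (Fin 3) → ℝ := fun x =>
    (3 * ⟪m, x⟫ * ⟪m₀, x⟫ - ‖x‖ ^ 2 * ⟪m, m₀⟫) / ‖x‖ ^ 5 with hf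
  have hfint : IntegrableOn f (Metric.ball R a) := by
    refine IntegrableOn.mono_set (ContinuousOn.integrableOn_compact (isCompact_closedBall R a) ?_)
      Metric.ball_subset_closedBall
    refine ContinuousOn.div (by fun_prop) (by fun_prop) fun x hx => pow_ne_zero 5 ?_
    rw [norm_ne_zero_iff]
    rintro rfl
    rw [Metric.mem_closedBall, dist_zero_left] at hx
    exact absurd hx (not_le.2 hR)
  have hnorm : ∀ p, ‖e p‖ = √(p.1 ^ 2 + p.2.1 ^ 2 + p.2.2 ^ 2) := fun p => by
    rw [hep, eq_comm, sqrt_eq_iff_mul_self_eq (by positivity) (by positivity), ← pow_two,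
      ← b.sum_sq_norm_inner_right]
    simp [Fin.sum_univ_three, inner_add_right, inner_smul_right, b.inner_eq_ite]
  have hball : ∀ p, e p ∈ Metric.ball R a ↔
      p.2.1 ^ 2 + p.2.2 ^ 2 < √(a ^ 2 - (p.1 - r) ^ 2) ^ 2 := fun p => by
    have h1 : e p - R = e (p.1 - r, p.2) := by
      rw [hep, hep]
      nth_rw 1 [hb]
      module
    rw [mem_ball_iff_norm, h1, hnorm, sqrt_lt' ha]
    rcases le_total 0 (a ^ 2 - (p.1 - r) ^ 2) with h | h
    · rw [sq_sqrt h]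
      constructor <;> intro h <;> simp only at * <;> linarith
    · rw [sqrt_eq_zero_of_nonpos h]
      constructor <;> intro h' <;> simp only at * <;> nlinarith [sq_nonneg p.2.1, sq_nonneg p.2.2]
  have hmm : ⟪m, m₀⟫ = ⟪m, b 0⟫ * ⟪m₀, b 0⟫ + ⟪m, b 1⟫ * ⟪m₀, b 1⟫ + ⟪m, b 2⟫ * ⟪m₀, b 2⟫ := by
    rw [← b.sum_inner_mul_inner m m₀, Fin.sum_univ_three]
    simp only [real_inner_comm m₀]
  set α := ⟪m, b 0⟫
  set β := ⟪m, b 1⟫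
  set γ := ⟪m, b 2⟫
  set α' := ⟪m₀, b 0⟫
  set β' := ⟪m₀, b 1⟫
  set γ' := ⟪m₀, b 2⟫
  have hfe : ∀ p, f (e p) =
      (3 * (α * p.1 + β * p.2.1 + γ * p.2.2) * (α' * p.1 + β' * p.2.1 + γ' * p.2.2) -
          (p.1 ^ 2 + p.2.1 ^ 2 + p.2.2 ^ 2) * (α * α' + β * β' + γ * γ')) /
          √(p.1 ^ 2 + p.2.1 ^ 2 + p.2.2 ^ 2) ^ 5 := fun p => by
    simp only [hf]
    rw [hnorm, sq_sqrt (by positivity), hmm, hep]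
    simp only [inner_add_right, inner_smul_right]
    congr 2
    ring
  have hint : Integrable (fun p => (Metric.ball R a).indicator f (e p)) (volume.prod volume) :=
    he.integrable_comp_of_integrable ((integrable_indicator_iff measurableSet_ball).2 hfint)
  have hslice : ∀ z, ∫ p, (Metric.ball R a).indicator f (e (z, p)) =
      (Set.Ioo (r - a) (r + a)).indicator (fun z => π * (2 * (α * α') - β * β' - γ * γ') *
        ((a ^ 2 - (z - r) ^ 2) / √(z ^ 2 + (a ^ 2 - (z - r) ^ 2)) ^ 3)) z := fun z => by
    have h1 : (fun p => (Metric.ball R a).indicator f (e (z, p))) =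
        {p : ℝ × ℝ | p.1 ^ 2 + p.2 ^ 2 < √(a ^ 2 - (z - r) ^ 2) ^ 2}.indicator
          (fun p => f (e (z, p))) := by
      ext p
      simp only [Set.indicator, hball, Set.mem_ofPred_eq]
    by_cases hz : z ∈ Set.Ioo (r - a) (r + a)
    · have h0 : 0 ≤ a ^ 2 - (z - r) ^ 2 := by nlinarith [hz.1, hz.2]
      rw [h1, integral_indicator (measurableSet_lt (by fun_prop) (by fun_prop)),
        Set.indicator_of_mem hz]
      simp only [hfe]
      rw [integral_disc_dipole (by linarith [hz.1]) (sqrt_nonneg _), sq_sqrt h0]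
    · have h0 : a ^ 2 - (z - r) ^ 2 ≤ 0 := by
        by_contra! h
        have := abs_lt_of_sq_lt_sq' (sub_pos.1 h) ha.le
        exact hz ⟨by linarith, by linarith⟩
      rw [Set.indicator_of_notMem hz, h1, sqrt_eq_zero_of_nonpos h0]
      have : {p : ℝ × ℝ | p.1 ^ 2 + p.2 ^ 2 < 0 ^ 2} = ∅ := by
        ext p
        simp only [Set.mem_ofPred_eq, Set.mem_empty_iff_false, iff_false, not_lt]
        nlinarith [sq_nonneg p.1, sq_nonneg p.2]
      rw [this, Set.indicator_empty, integral_zero]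
  have hmR : ⟪m, R⟫ = r * α := by rw [hb, inner_smul_right]
  have hmR' : ⟪m₀, R⟫ = r * α' := by rw [hb, inner_smul_right]
  rw [← integral_indicator measurableSet_ball, ← he.integral_comp', Measure.volume_eq_prod,
    integral_prod _ hint]
  simp only [hslice]
  rw [integral_indicator measurableSet_Ioo, integral_const_mul, integral_axial_dipole ha hR, hmm,
    hmR, hmR']
  field_simp
  ring
end

section
/- For all t ∈ (0, 2π) the kernel functions satisfy the identity K̄₀₀(t) + K̄₀₁′(t) − K̄₁₁″(t) + K̄₀₂″(t) − K̄₁₂‴(t) + K̄₂₂⁗(t) = 0, where primes denote ordinary (iterated) derivatives with respect to t. -/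
open Real Filter

/-- Kernel `K̄₀₀(t) = (115 + 76 cos t + cos 2t)/(128 sin⁵(t/2))`. -/
noncomputable def Kb00 (t : ℝ) : ℝ :=
  (115 + 76 * Real.cos t + Real.cos (2 * t)) / (128 * Real.sin (t / 2) ^ 5)

/-- Kernel `K̄₀₁(t) = 3(22 sin t + sin 2t)/(64 sin⁵(t/2))`. -/
noncomputable def Kb01 (t : ℝ) : ℝ :=
  3 * (22 * Real.sin t + Real.sin (2 * t)) / (64 * Real.sin (t / 2) ^ 5)

/-- Kernel `K̄₁₁(t) = 3(−35 + 3 cos 2t)/(128 sin⁵(t/2))`. -/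
noncomputable def Kb11 (t : ℝ) : ℝ :=
  3 * (-35 + 3 * Real.cos (2 * t)) / (128 * Real.sin (t / 2) ^ 5)

/-- Kernel `K̄₀₂(t) = (3 + cos t)/(8 sin³(t/2))`. -/
noncomputable def Kb02 (t : ℝ) : ℝ :=
  (3 + Real.cos t) / (8 * Real.sin (t / 2) ^ 3)

/-- Kernel `K̄₁₂(t) = 3(−6 sin t + sin 2t)/(32 sin⁵(t/2))`. -/
noncomputable def Kb12 (t : ℝ) : ℝ :=
  3 * (-6 * Real.sin t + Real.sin (2 * t)) / (32 * Real.sin (t / 2) ^ 5)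

/-- Kernel `K̄₂₂(t) = (3 − cos t)/(8 sin³(t/2))`. -/
noncomputable def Kb22 (t : ℝ) : ℝ :=
  (3 - Real.cos t) / (8 * Real.sin (t / 2) ^ 3)

/-- Odd polynomial in the cosecant of the half angle. -/
noncomputable def cscOdd (a b c d t : ℝ) : ℝ :=
  a * (sin (t / 2))⁻¹ + b * (sin (t / 2))⁻¹ ^ 3 + c * (sin (t / 2))⁻¹ ^ 5
    + d * (sin (t / 2))⁻¹ ^ 7

/-- Even polynomial in the cosecant of the half angle, times the cosine of the half angle. -/
noncomputable def cosCscEven (a b c t : ℝ) : ℝ :=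
  cos (t / 2) * (a * (sin (t / 2))⁻¹ ^ 2 + b * (sin (t / 2))⁻¹ ^ 4 + c * (sin (t / 2))⁻¹ ^ 6)

theorem sin_half_ne_zero {t : ℝ} (ht : t ∈ Set.Ioo (0 : ℝ) (2 * π)) : sin (t / 2) ≠ 0 :=
  (sin_pos_of_pos_of_lt_pi (by linarith [ht.1]) (by linarith [ht.2])).ne'

theorem hasDerivAt_sin_half (t : ℝ) :
    HasDerivAt (fun x : ℝ => sin (x / 2)) (cos (t / 2) * (1 / 2)) t :=
  ((hasDerivAt_id t).div_const 2).sin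

theorem hasDerivAt_cos_half (t : ℝ) :
    HasDerivAt (fun x : ℝ => cos (x / 2)) (-sin (t / 2) * (1 / 2)) t :=
  ((hasDerivAt_id t).div_const 2).cos

theorem hasDerivAt_cscOdd (a b c : ℝ) {t : ℝ} (h : sin (t / 2) ≠ 0) :
    HasDerivAt (cscOdd a b c 0) (cosCscEven (-a / 2) (-3 * b / 2) (-5 * c / 2) t) t := by
  have hu := (hasDerivAt_sin_half t).fun_inv h
  have key := (((hu.const_mul a).fun_add ((hu.fun_pow 3).const_mul b)).fun_add
    ((hu.fun_pow 5).const_mul c)).fun_add ((hu.fun_pow 7).const_mul 0)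
  refine key.congr_deriv ?_
  unfold cosCscEven
  simp only [Nat.reduceSub, Nat.cast_ofNat]
  field_simp
  ring

theorem hasDerivAt_cosCscEven (a b c : ℝ) {t : ℝ} (h : sin (t / 2) ≠ 0) :
    HasDerivAt (cosCscEven a b c)
      (cscOdd (a / 2) (3 * b / 2 - a) (5 * c / 2 - 2 * b) (-3 * c) t) t := by
  have hu := (hasDerivAt_sin_half t).fun_inv h
  have key := (hasDerivAt_cos_half t).fun_mul ((((hu.fun_pow 2).const_mul a).fun_add
    ((hu.fun_pow 4).const_mul b)).fun_add ((hu.fun_pow 6).const_mul c))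
  refine key.congr_deriv ?_
  unfold cscOdd
  simp only [Nat.reduceSub, Nat.cast_ofNat]
  field_simp
  ring_nf
  simp only [cos_sq']
  ring

theorem eqOn_deriv_of_eqOn_cosCscEven {f : ℝ → ℝ} {a b c : ℝ}
    (hf : Set.EqOn f (cosCscEven a b c) (Set.Ioo 0 (2 * π))) :
    Set.EqOn (deriv f) (cscOdd (a / 2) (3 * b / 2 - a) (5 * c / 2 - 2 * b) (-3 * c))
      (Set.Ioo 0 (2 * π)) := fun _ ht =>
  (hf.deriv isOpen_Ioo ht).trans (hasDerivAt_cosCscEven a b c (sin_half_ne_zero ht)).deriv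

theorem eqOn_deriv_deriv_of_eqOn_cscOdd {f : ℝ → ℝ} {a b c : ℝ}
    (hf : Set.EqOn f (cscOdd a b c 0) (Set.Ioo 0 (2 * π))) :
    Set.EqOn (deriv (deriv f))
      (cscOdd (-a / 4) (a / 2 - 9 * b / 4) (3 * b - 25 * c / 4) (15 * c / 2))
      (Set.Ioo 0 (2 * π)) := by
  have h : Set.EqOn (deriv f) (cosCscEven (-a / 2) (-3 * b / 2) (-5 * c / 2))
      (Set.Ioo 0 (2 * π)) := fun t ht =>
    (hf.deriv isOpen_Ioo ht).trans (hasDerivAt_cscOdd a b c (sin_half_ne_zero ht)).deriv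
  convert eqOn_deriv_of_eqOn_cosCscEven h using 2 <;> ring

theorem cos_eq_sin_half (t : ℝ) : cos t = 1 - 2 * sin (t / 2) ^ 2 := by
  have h := cos_two_mul (t / 2)
  rw [mul_div_cancel₀ t two_ne_zero, cos_sq'] at h
  linarith

theorem sin_eq_sin_half_mul_cos_half (t : ℝ) : sin t = 2 * sin (t / 2) * cos (t / 2) := by
  rw [← sin_two_mul, mul_div_cancel₀ t two_ne_zero]

theorem Kb00_eqOn :
    Set.EqOn Kb00 (cscOdd (1 / 16) (-5 / 4) (3 / 2) 0) (Set.Ioo 0 (2 * π)) := fun t ht => by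
  have h := sin_half_ne_zero ht
  simp only [Kb00, cscOdd, cos_two_mul t, cos_eq_sin_half t]
  field_simp
  ring

theorem Kb11_eqOn :
    Set.EqOn Kb11 (cscOdd (9 / 16) (-9 / 16) (-3 / 4) 0) (Set.Ioo 0 (2 * π)) := fun t ht => by
  have h := sin_half_ne_zero ht
  simp only [Kb11, cscOdd, cos_two_mul t, cos_eq_sin_half t]
  field_simp
  ring

theorem Kb02_eqOn :
    Set.EqOn Kb02 (cscOdd (-1 / 4) (1 / 2) 0 0) (Set.Ioo 0 (2 * π)) := fun t ht => by
  have h := sin_half_ne_zero ht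
  simp only [Kb02, cscOdd, cos_eq_sin_half t]
  field_simp
  ring

theorem Kb22_eqOn :
    Set.EqOn Kb22 (cscOdd (1 / 4) (1 / 4) 0 0) (Set.Ioo 0 (2 * π)) := fun t ht => by
  have h := sin_half_ne_zero ht
  simp only [Kb22, cscOdd, cos_eq_sin_half t]
  field_simp
  ring

theorem Kb01_eqOn :
    Set.EqOn Kb01 (cosCscEven (-3 / 8) (9 / 4) 0) (Set.Ioo 0 (2 * π)) := fun t ht => by
  have h := sin_half_ne_zero ht
  simp only [Kb01, cosCscEven, sin_two_mul t, sin_eq_sin_half_mul_cos_half t, cos_eq_sin_half t]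
  field_simp
  ring

theorem Kb12_eqOn :
    Set.EqOn Kb12 (cosCscEven (-3 / 4) (-3 / 4) 0) (Set.Ioo 0 (2 * π)) := fun t ht => by
  have h := sin_half_ne_zero ht
  simp only [Kb12, cosCscEven, sin_two_mul t, sin_eq_sin_half_mul_cos_half t, cos_eq_sin_half t]
  field_simp
  ring

/-- The kernel identity
`K̄₀₀ + K̄₀₁′ − K̄₁₁″ + K̄₀₂″ − K̄₁₂‴ + K̄₂₂⁗ = 0` on `(0, 2π)`. -/
theorem kernel_identity :
    ∀ t ∈ Set.Ioo (0 : ℝ) (2 * π),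
      Kb00 t + deriv Kb01 t - iteratedDeriv 2 Kb11 t + iteratedDeriv 2 Kb02 t
        - iteratedDeriv 3 Kb12 t + iteratedDeriv 4 Kb22 t = 0 := by
  intro t ht
  have h01 := eqOn_deriv_of_eqOn_cosCscEven Kb01_eqOn ht
  have h11 := eqOn_deriv_deriv_of_eqOn_cscOdd Kb11_eqOn ht
  have h02 := eqOn_deriv_deriv_of_eqOn_cscOdd Kb02_eqOn ht
  have h12' : Set.EqOn (deriv Kb12) (cscOdd (-3 / 8) (-3 / 8) (3 / 2) 0)
      (Set.Ioo 0 (2 * π)) := by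
    convert eqOn_deriv_of_eqOn_cosCscEven Kb12_eqOn using 2 <;> norm_num
  have h12 := eqOn_deriv_deriv_of_eqOn_cscOdd h12' ht
  have h22' : Set.EqOn (deriv (deriv Kb22)) (cscOdd (-1 / 16) (-7 / 16) (3 / 4) 0)
      (Set.Ioo 0 (2 * π)) := by
    convert eqOn_deriv_deriv_of_eqOn_cscOdd Kb22_eqOn using 2 <;> norm_num
  have h22 := eqOn_deriv_deriv_of_eqOn_cscOdd h22' ht
  simp only [iteratedDeriv_succ, iteratedDeriv_zero]
  rw [Kb00_eqOn ht, h01, h11, h02, h12, h22]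
  unfold cscOdd
  ring
end

section
/- The Hadamard finite part of the circular-ring energy integral equals −1/3: lim_{ε→0⁺} ( ∫_ε^{π−ε} (1 + cos²θ)/sin³θ dθ − 2/ε² ) = −1/3. -/
open Real Filter

theorem hasDerivAt_neg_cos_div_sin_sq {x : ℝ} (hx : sin x ≠ 0) :
    HasDerivAt (fun θ : ℝ => -cos θ / sin θ ^ 2) ((1 + cos x ^ 2) / sin x ^ 3) x := by
  have h := (hasDerivAt_cos x).neg.div ((hasDerivAt_sin x).pow 2) (pow_ne_zero 2 hx)
  refine h.congr_deriv ?_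
  have hc := sin_sq_add_cos_sq x
  simp only [Pi.neg_apply, Pi.pow_apply]
  field_simp
  push_cast
  norm_num
  linear_combination sin x * hc

theorem integral_one_add_cos_sq_div_sin_cube {ε : ℝ} (h0 : 0 < ε) (h1 : ε < π / 2) :
    ∫ θ in ε..(π - ε), (1 + cos θ ^ 2) / sin θ ^ 3 = 2 * cos ε / sin ε ^ 2 := by
  have hs : ∀ x ∈ Set.uIcc ε (π - ε), sin x ≠ 0 := by
    intro x hx
    rw [Set.uIcc_of_le (by linarith)] at hx
    exact (sin_pos_of_pos_of_lt_pi (by linarith [hx.1]) (by linarith [hx.2])).ne'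
  rw [intervalIntegral.integral_eq_sub_of_hasDerivAt
    (fun x hx => hasDerivAt_neg_cos_div_sin_sq (hs x hx))]
  · rw [cos_pi_sub, sin_pi_sub]
    ring
  · apply ContinuousOn.intervalIntegrable
    exact ContinuousOn.div (by fun_prop) (by fun_prop) fun x hx => pow_ne_zero 3 (hs x hx)

theorem tendsto_sub_sin_div_cube :
    Tendsto (fun ε : ℝ => (ε - sin ε) / ε ^ 3) (nhdsWithin 0 (Set.Ioi 0)) (nhds (1 / 6)) := by
  rw [tendsto_iff_dist_tendsto_zero]
  have hb : Tendsto (fun ε : ℝ => ε ^ 2 / 100) (nhdsWithin 0 (Set.Ioi 0)) (nhds 0) :=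
    ((by fun_prop : Continuous fun ε : ℝ => ε ^ 2 / 100).tendsto' 0 0 (by norm_num)).mono_left
      nhdsWithin_le_nhds
  refine squeeze_zero' (.of_forall fun _ => dist_nonneg) ?_ hb
  filter_upwards [Ioo_mem_nhdsGT (zero_lt_one' ℝ)] with ε hε
  have h0 : 0 < ε := hε.1
  have h := sin_bound (x := ε) (by rw [abs_of_pos h0]; exact hε.2.le)
  rw [abs_of_pos h0] at h
  have e : (ε - sin ε) / ε ^ 3 - 1 / 6 = -(sin ε - (ε - ε ^ 3 / 6)) / ε ^ 3 := by
    field_simp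
    ring
  rw [Real.dist_eq, e, abs_div, abs_neg, abs_of_pos (pow_pos h0 3), div_le_iff₀ (pow_pos h0 3)]
  linarith

theorem tendsto_one_sub_cos_div_sq :
    Tendsto (fun ε : ℝ => (1 - cos ε) / ε ^ 2) (nhdsWithin 0 (Set.Ioi 0)) (nhds (1 / 2)) := by
  rw [tendsto_iff_dist_tendsto_zero]
  have hb : Tendsto (fun ε : ℝ => ε ^ 2 * (5 / 96)) (nhdsWithin 0 (Set.Ioi 0)) (nhds 0) :=
    ((by fun_prop : Continuous fun ε : ℝ => ε ^ 2 * (5 / 96)).tendsto' 0 0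
      (by norm_num)).mono_left nhdsWithin_le_nhds
  refine squeeze_zero' (.of_forall fun _ => dist_nonneg) ?_ hb
  filter_upwards [Ioo_mem_nhdsGT (zero_lt_one' ℝ)] with ε hε
  have h0 : 0 < ε := hε.1
  have h := cos_bound (x := ε) (by rw [abs_of_pos h0]; exact hε.2.le)
  rw [abs_of_pos h0] at h
  have e : (1 - cos ε) / ε ^ 2 - 1 / 2 = -(cos ε - (1 - ε ^ 2 / 2)) / ε ^ 2 := by
    field_simp
    ring
  rw [Real.dist_eq, e, abs_div, abs_neg, abs_of_pos (pow_pos h0 2), div_le_iff₀ (pow_pos h0 2)]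
  linarith

/-- The Hadamard finite part of the circular-ring energy integral:
`lim_{ε→0⁺} ( ∫_ε^{π−ε} (1 + cos²θ)/sin³θ dθ − 2/ε² ) = −1/3`. -/
theorem finite_part_ring_integral :
    Tendsto
      (fun ε : ℝ =>
        (∫ θ in ε..(π - ε), (1 + Real.cos θ ^ 2) / Real.sin θ ^ 3) - 2 / ε ^ 2)
      (nhdsWithin 0 (Set.Ioi 0)) (nhds (-1 / 3)) := by
  have ha := tendsto_sub_sin_div_cube
  have hb := tendsto_one_sub_cos_div_sq
  have hε : Tendsto (fun ε : ℝ => ε ^ 2) (nhdsWithin 0 (Set.Ioi 0)) (nhds 0) :=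
    ((continuous_pow 2).tendsto' 0 0 (by norm_num)).mono_left nhdsWithin_le_nhds
  have hnum := (((ha.const_mul 2).sub hb).sub (hε.mul (ha.pow 2))).const_mul 2
  have hden := ((hε.mul ha).const_sub 1).pow 2
  have h := hnum.div hden (by norm_num)
  rw [show (2 * (2 * (1 / 6) - 1 / 2 - 0 * (1 / 6) ^ 2) / (1 - 0 * (1 / 6)) ^ 2 : ℝ) = -1 / 3 by
    norm_num] at h
  refine h.congr' ?_
  filter_upwards [Ioo_mem_nhdsGT (half_pos pi_pos)] with ε hε
  have h0 : 0 < ε := hε.1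
  have hs : sin ε ≠ 0 := (sin_pos_of_pos_of_lt_pi h0 (by linarith [hε.2, pi_pos])).ne'
  rw [integral_one_add_cos_sq_div_sin_cube h0 hε.2]
  have e : 1 - ε ^ 2 * ((ε - sin ε) / ε ^ 3) = sin ε / ε := by
    field_simp
    ring
  simp only [Pi.div_apply]
  rw [e]
  field_simp
  ring
end

section
/- The kernel K̄₀₁ has the small-argument expansion K̄₀₁(t) = 36/t⁴ − 7/160 + O(t) as t → 0⁺; in particular lim_{t→0⁺} ( K̄₀₁(t) − 36/t⁴ ) = −7/160. -/
open Real Filter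

open Asymptotics

/-- The fourth-order Taylor polynomials of `cos` and of `sin u / u`, with remainders controlled on
`(0, 1]`. -/
theorem exists_cos_sin_taylor_remainder {u : ℝ} (hu0 : 0 < u) (hu1 : u ≤ 1) :
    ∃ a ∈ Set.Icc (-1 / 100 : ℝ) (1 / 100), ∃ b ∈ Set.Icc (-1 / 100 : ℝ) (1 / 100),
      Real.cos u = 1 - u ^ 2 / 2 + u ^ 4 / 24 + u ^ 5 * b ∧
      Real.sin u = u * (1 - u ^ 2 / 6 + u ^ 4 / 120 + u ^ 5 * a) := by
  have hnorm : ‖(u : ℂ) * Complex.I‖ = u := by simp [abs_of_pos hu0]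
  have h := Complex.exp_bound (x := (u : ℂ) * Complex.I) (by rw [hnorm]; exact hu1)
    (n := 6) (by norm_num)
  rw [hnorm] at h
  have hz : Complex.exp ((u : ℂ) * Complex.I)
      - ∑ m ∈ Finset.range 6, ((u : ℂ) * Complex.I) ^ m / (m.factorial : ℂ)
      = ((Real.cos u - (1 - u ^ 2 / 2 + u ^ 4 / 24) : ℝ) : ℂ)
        + ((Real.sin u - (u - u ^ 3 / 6 + u ^ 5 / 120) : ℝ) : ℂ) * Complex.I := by
    have h3 : Complex.I ^ 3 = -Complex.I := Complex.I_pow_three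
    have h4 : Complex.I ^ 4 = 1 := Complex.I_pow_four
    have h5 : Complex.I ^ 5 = Complex.I := by rw [pow_succ, h4, one_mul]
    rw [Complex.exp_mul_I]
    simp only [Finset.sum_range_succ, Finset.sum_range_zero, mul_pow, Complex.I_sq, h3, h4, h5,
      Nat.factorial]
    push_cast
    ring
  rw [hz] at h
  have hre := (Complex.abs_re_le_norm _).trans h
  have him := (Complex.abs_im_le_norm _).trans h
  simp only [Complex.add_re, Complex.add_im, Complex.re_ofReal_mul, Complex.im_ofReal_mul,
    Complex.ofReal_re, Complex.ofReal_im, Complex.I_re, Complex.I_im, mul_zero, mul_one, add_zero,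
    zero_add] at hre him
  norm_num [Nat.factorial] at hre him
  have hu6 : 0 < u ^ 6 := by positivity
  have hu65 : u ^ 6 ≤ u ^ 5 := pow_le_pow_of_le_one hu0.le hu1 (by norm_num)
  rw [abs_le] at hre him
  refine ⟨(Real.sin u - (u - u ^ 3 / 6 + u ^ 5 / 120)) / u ^ 6, ⟨?_, ?_⟩,
    (Real.cos u - (1 - u ^ 2 / 2 + u ^ 4 / 24)) / u ^ 5, ⟨?_, ?_⟩, ?_, ?_⟩
  · rw [le_div_iff₀ hu6]; linarith [him.1]
  · rw [div_le_iff₀ hu6]; linarith [him.2]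
  · rw [le_div_iff₀ (by positivity)]; linarith [hre.1]
  · rw [div_le_iff₀ (by positivity)]; linarith [hre.2]
  · field_simp
    ring
  · field_simp
    ring

/-- Replacing `sin u` and `cos u` by Taylor polynomials with remainders `a` and `b`, the numerator
of `Kb01 (2 * u) - 36 / (2 * u) ^ 4 + 7 / 160` is divisible by `u ^ 5`; this is the quotient. -/
noncomputable def Kb01Remainder (u a b : ℝ) : ℝ :=
  let C := 1 - u ^ 2 / 2 + u ^ 4 / 24
  let P := 1 - u ^ 2 / 6 + u ^ 4 / 120
  let S := P + u ^ 5 * a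
  3 / 8 * (b * (6 - u ^ 2 * S ^ 2) - C * u ^ 2 * a * (S + P))
    - (9 / 4 - 7 / 160 * u ^ 4) * a * (S + P) * (S ^ 2 + P ^ 2)
    - 43 / 960 * u + 83 / 5760 * u ^ 3 - 733 / 345600 * u ^ 5 + 103 / 518400 * u ^ 7
    - 541 / 41472000 * u ^ 9 + 11 / 18432000 * u ^ 11 - 7 / 414720000 * u ^ 13
    + 7 / 33177600000 * u ^ 15

theorem exists_abs_Kb01Remainder_le :
    ∃ M : ℝ, ∀ u ∈ Set.Icc (0 : ℝ) 1, ∀ a ∈ Set.Icc (-1 / 100 : ℝ) (1 / 100),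
      ∀ b ∈ Set.Icc (-1 / 100 : ℝ) (1 / 100), |Kb01Remainder u a b| ≤ M := by
  have hK : IsCompact (Set.Icc (0 : ℝ) 1 ×ˢ
      (Set.Icc (-1 / 100 : ℝ) (1 / 100) ×ˢ Set.Icc (-1 / 100 : ℝ) (1 / 100))) :=
    isCompact_Icc.prod (isCompact_Icc.prod isCompact_Icc)
  have hc : Continuous fun p : ℝ × ℝ × ℝ => Kb01Remainder p.1 p.2.1 p.2.2 := by
    unfold Kb01Remainder
    fun_prop
  obtain ⟨M, hM⟩ := hK.exists_bound_of_continuousOn hc.continuousOn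
  exact ⟨M, fun u hu a ha b hb => hM (u, a, b) ⟨hu, ha, hb⟩⟩

theorem Kb01_two_mul {u : ℝ} (hs : Real.sin u ≠ 0) :
    Kb01 (2 * u) = 3 / 8 * Real.cos u * (6 - Real.sin u ^ 2) / Real.sin u ^ 4 := by
  have h2 : 2 * u / 2 = u := by ring
  rw [Kb01, h2, Real.sin_two_mul (2 * u), Real.sin_two_mul u, Real.cos_two_mul u]
  rw [Real.cos_sq']
  field_simp
  ring

theorem exists_abs_Kb01_sub_le :
    ∃ M : ℝ, ∀ u : ℝ, 0 < u → u ≤ 1 →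
      |Kb01 (2 * u) - 36 / (2 * u) ^ 4 + 7 / 160| ≤ M * u := by
  obtain ⟨M, hM⟩ := exists_abs_Kb01Remainder_le
  refine ⟨16 * M, fun u hu0 hu1 => ?_⟩
  obtain ⟨a, ha, b, hb, hcos, hsin⟩ := exists_cos_sin_taylor_remainder hu0 hu1
  have hQ := hM u ⟨hu0.le, hu1⟩ a ha b hb
  set S := 1 - u ^ 2 / 6 + u ^ 4 / 120 + u ^ 5 * a with hS
  have hS2 : 1 / 2 ≤ S := by
    have h2 : u ^ 2 ≤ 1 := pow_le_one₀ hu0.le hu1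
    have h5 : u ^ 5 ≤ 1 := pow_le_one₀ hu0.le hu1
    have h5' : 0 ≤ u ^ 5 := by positivity
    have h4 : 0 ≤ u ^ 4 := by positivity
    have := mul_le_mul_of_nonneg_left ha.1 h5'
    linarith
  have hS0 : 0 < S := by linarith
  have hs : Real.sin u ≠ 0 := by rw [hsin]; positivity
  have key : Kb01 (2 * u) - 36 / (2 * u) ^ 4 + 7 / 160 = u * Kb01Remainder u a b / S ^ 4 := by
    have hnum : 3 / 8 * Real.cos u * (6 - u ^ 2 * S ^ 2) - (9 / 4 - 7 / 160 * u ^ 4) * S ^ 4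
        = u ^ 5 * Kb01Remainder u a b := by
      rw [hcos, hS, Kb01Remainder]
      ring
    rw [Kb01_two_mul hs, hsin]
    have : u * Kb01Remainder u a b / S ^ 4 = u ^ 5 * Kb01Remainder u a b / (u ^ 4 * S ^ 4) := by
      field_simp
    rw [this, ← hnum]
    field_simp
    ring
  have hS4 : (1 / 16 : ℝ) ≤ S ^ 4 := by
    calc (1 / 16 : ℝ) = (1 / 2) ^ 4 := by norm_num
      _ ≤ S ^ 4 := by gcongr
  rw [key, abs_div, abs_mul, abs_of_pos hu0, abs_of_pos (pow_pos hS0 4),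
    div_le_iff₀ (pow_pos hS0 4)]
  have hM0 : 0 ≤ M := (abs_nonneg _).trans hQ
  calc u * |Kb01Remainder u a b| ≤ u * M := by gcongr
    _ = 16 * M * u * (1 / 16) := by ring
    _ ≤ 16 * M * u * S ^ 4 := by gcongr

/-- Small-argument expansion `K̄₀₁(t) = 36/t⁴ − 7/160 + O(t)` as `t → 0⁺`;
in particular `lim_{t→0⁺} (K̄₀₁(t) − 36/t⁴) = −7/160`. -/
theorem K01_expansion :
    (fun t : ℝ => Kb01 t - 36 / t ^ 4 + 7 / 160) =O[nhdsWithin 0 (Set.Ioi 0)]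
        (fun t : ℝ => t) ∧
      Tendsto (fun t : ℝ => Kb01 t - 36 / t ^ 4) (nhdsWithin 0 (Set.Ioi 0))
        (nhds (-7 / 160)) := by
  have hO : (fun t : ℝ => Kb01 t - 36 / t ^ 4 + 7 / 160) =O[nhdsWithin 0 (Set.Ioi 0)]
      (fun t : ℝ => t) := by
    obtain ⟨M, hM⟩ := exists_abs_Kb01_sub_le
    refine IsBigO.of_bound (M / 2) ?_
    filter_upwards [Ioc_mem_nhdsGT (show (0 : ℝ) < 2 by norm_num)] with t ht
    have h := hM (t / 2) (by linarith [ht.1]) (by linarith [ht.2])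
    rw [mul_div_cancel₀ t (two_ne_zero : (2 : ℝ) ≠ 0)] at h
    rw [Real.norm_eq_abs, Real.norm_eq_abs, abs_of_pos ht.1]
    linarith
  refine ⟨hO, ?_⟩
  have h0 := (hO.trans_tendsto (tendsto_id.mono_left nhdsWithin_le_nhds)).sub_const (7 / 160)
  convert h0 using 2 <;> ring
end

section
/- For every real X ∉ ℤ the limit Λ₁(X) = lim_{K→∞} ( −2 log K + Σ_{i=−K}^{K} 1/|X − i| ) exists, and the regularized value at the singularity satisfies lim_{X→0, X≠0} ( Λ₁(X) − 1/|X| ) = 2γ, where γ is the Euler–Mascheroni constant. -/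
open Real Filter

/-- The logarithmically renormalized lattice sum
`Λ₁(X) = lim_{K→∞} ( −2 log K + Σ_{i=−K}^{K} 1/|X − i| )`. -/
noncomputable def Lambda1 (X : ℝ) : ℝ :=
  limUnder atTop
    (fun K : ℕ => -2 * Real.log K + ∑ i ∈ Finset.Icc (-(K : ℤ)) (K : ℤ), 1 / |X - (i : ℝ)|)

/-- The `k`-th symmetric pair of lattice terms, with its value at `X = 0` subtracted. -/
noncomputable def pairTerm (X : ℝ) (k : ℕ) : ℝ :=
  1 / |X - (k + 1 : ℝ)| + 1 / |X + (k + 1 : ℝ)| - 2 / (k + 1 : ℝ)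

lemma abs_pairTerm_le {X : ℝ} {k : ℕ} (h : 2 * |X| ≤ (k + 1 : ℝ)) :
    |pairTerm X k| ≤ 3 * X ^ 2 * (1 / ((k + 1 : ℕ) : ℝ) ^ 2) := by
  unfold pairTerm
  push_cast
  have hn : (1 : ℝ) ≤ (k + 1 : ℝ) := by linarith [(Nat.cast_nonneg k : (0 : ℝ) ≤ k)]
  generalize (k + 1 : ℝ) = n at h hn
  have h₁ := le_abs_self X
  have h₂ := neg_abs_le X
  have hs : 4 * X ^ 2 ≤ n ^ 2 := by nlinarith [sq_abs X, abs_nonneg X]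
  have hm : 0 < n - X := by linarith
  have hp : 0 < X + n := by linarith
  rw [abs_of_neg (show X - n < 0 by linarith), abs_of_pos hp]
  have hd : 0 < n ^ 2 - X ^ 2 := by nlinarith
  have e : 1 / -(X - n) + 1 / (X + n) - 2 / n = 2 * X ^ 2 / (n * (n ^ 2 - X ^ 2)) := by
    rw [neg_sub, show n ^ 2 - X ^ 2 = (n - X) * (X + n) by ring]
    field_simp
    ring
  rw [e, abs_of_nonneg (by positivity), mul_one_div, div_le_div_iff₀ (by positivity) (by positivity)]
  have key : 2 * n ^ 2 ≤ 3 * (n * (n ^ 2 - X ^ 2)) := by nlinarith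
  nlinarith [mul_le_mul_of_nonneg_left key (sq_nonneg X)]

lemma summable_one_div_succ_sq : Summable fun k : ℕ => 1 / ((k + 1 : ℕ) : ℝ) ^ 2 :=
  (summable_nat_add_iff 1).2 (Real.summable_one_div_nat_pow.2 one_lt_two)

lemma summable_pairTerm (X : ℝ) : Summable (pairTerm X) := by
  refine Summable.of_norm_bounded_eventually_nat
    (summable_one_div_succ_sq.mul_left (3 * X ^ 2)) ?_
  filter_upwards [tendsto_natCast_atTop_atTop.eventually_ge_atTop (2 * |X|)] with k hk
  exact abs_pairTerm_le (by linarith)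

lemma sum_Icc_one_div_abs_sub (X : ℝ) (K : ℕ) :
    ∑ i ∈ Finset.Icc (-(K : ℤ)) (K : ℤ), 1 / |X - (i : ℝ)| =
      1 / |X| + 2 * (harmonic K : ℝ) + ∑ k ∈ Finset.range K, pairTerm X k := by
  induction K with
  | zero => simp
  | succ K ih =>
    have hI : Finset.Icc (-((K + 1 : ℕ) : ℤ)) ((K + 1 : ℕ) : ℤ) =
        insert (-((K + 1 : ℕ) : ℤ)) (insert ((K + 1 : ℕ) : ℤ)
          (Finset.Icc (-(K : ℤ)) (K : ℤ))) := by
      ext i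
      simp only [Finset.mem_Icc, Finset.mem_insert]
      omega
    rw [hI, Finset.sum_insert (by simp only [Finset.mem_Icc, Finset.mem_insert]; omega),
      Finset.sum_insert (by simp only [Finset.mem_Icc]; omega), ih, harmonic_succ,
      Finset.sum_range_succ, pairTerm]
    push_cast
    rw [sub_neg_eq_add]
    ring

lemma tendsto_renormalized_sum (X : ℝ) :
    Tendsto
      (fun K : ℕ =>
        -2 * Real.log K + ∑ i ∈ Finset.Icc (-(K : ℤ)) (K : ℤ), 1 / |X - (i : ℝ)|)
      atTop (nhds (1 / |X| + 2 * Real.eulerMascheroniConstant + ∑' k, pairTerm X k)) := by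
  refine (((Real.tendsto_harmonic_sub_log.const_mul 2).const_add (1 / |X|)).add
    (summable_pairTerm X).hasSum.tendsto_sum_nat).congr fun K => ?_
  rw [sum_Icc_one_div_abs_sub]
  ring

lemma tendsto_tsum_pairTerm_zero :
    Tendsto (fun X : ℝ => ∑' k, pairTerm X k) (nhds 0) (nhds 0) := by
  refine squeeze_zero_norm' (a := fun X : ℝ => 3 * X ^ 2 * ∑' k : ℕ, 1 / ((k + 1 : ℕ) : ℝ) ^ 2)
    ?_ ?_
  · filter_upwards [Metric.ball_mem_nhds (0 : ℝ) one_half_pos] with X hX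
    rw [mem_ball_zero_iff, Real.norm_eq_abs] at hX
    rw [← tsum_mul_left]
    refine tsum_of_norm_bounded (summable_one_div_succ_sq.mul_left (3 * X ^ 2)).hasSum fun k => ?_
    exact abs_pairTerm_le (by linarith [(Nat.cast_nonneg k : (0 : ℝ) ≤ k)])
  · exact Continuous.tendsto' (by fun_prop) _ _ (by simp)

/-- For `X ∉ ℤ` the limit defining `Λ₁(X)` exists, and the regularized value at the
singularity satisfies `lim_{X→0, X≠0} ( Λ₁(X) − 1/|X| ) = 2γ`, with `γ` the
Euler–Mascheroni constant. -/
theorem Lambda1_exists_and_regularized :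
    (∀ X : ℝ, (∀ i : ℤ, X ≠ (i : ℝ)) → ∃ L : ℝ,
        Tendsto
          (fun K : ℕ =>
            -2 * Real.log K + ∑ i ∈ Finset.Icc (-(K : ℤ)) (K : ℤ), 1 / |X - (i : ℝ)|)
          atTop (nhds L)) ∧
      Tendsto (fun X : ℝ => Lambda1 X - 1 / |X|) (nhdsWithin 0 {0}ᶜ)
        (nhds (2 * Real.eulerMascheroniConstant)) := by
  refine ⟨fun X _ => ⟨_, tendsto_renormalized_sum X⟩, ?_⟩
  have h := (tendsto_tsum_pairTerm_zero.const_add (2 * Real.eulerMascheroniConstant)).mono_left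
    (nhdsWithin_le_nhds (s := {0}ᶜ))
  rw [add_zero] at h
  refine h.congr fun X => ?_
  rw [Lambda1, (tendsto_renormalized_sum X).limUnder_eq]
  ring
end

section
/- For every irrational s ∈ (0,1), lim_{n→∞} n² ( S₂(s, n) − n⁻¹ Λ₂(n s) ) = 1/(1−s) − 1/s, where S₂(s, n) = Σ_{i=0}^{n} n⁻³ sgn(s − i/n)/|s − i/n|². -/
open Real Filter

/-- The signed lattice sum `Λ₂(X) = Σ_{i∈ℤ} sgn(X − i)/|X − i|²`. -/
noncomputable def Lambda2 (X : ℝ) : ℝ :=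
  ∑' i : ℤ, Real.sign (X - (i : ℝ)) / |X - (i : ℝ)| ^ 2

/-- The finite sum `S₂(s, n) = Σ_{i=0}^{n} n⁻³ sgn(s − i/n)/|s − i/n|²`. -/
noncomputable def S2 (s : ℝ) (n : ℕ) : ℝ :=
  ∑ i ∈ Finset.range (n + 1),
    ((n : ℝ) ^ 3)⁻¹ * Real.sign (s - (i : ℝ) / n) / |s - (i : ℝ) / n| ^ 2

/-- The telescoping series `∑ (1/(x+j) - 1/(x+j+1))` sums to `1/x`. -/
lemma hasSum_inv_sub_inv_add_one {x : ℝ} (hx : 0 < x) :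
    HasSum (fun j : ℕ => 1 / (x + j) - 1 / (x + j + 1)) (1 / x) := by
  have hnonneg : ∀ j : ℕ, 0 ≤ 1 / (x + j) - 1 / (x + j + 1) := fun j =>
    sub_nonneg.2 (one_div_le_one_div_of_le (by positivity) (by linarith))
  rw [hasSum_iff_tendsto_nat_of_nonneg hnonneg]
  have hsum : ∀ n : ℕ, ∑ j ∈ Finset.range n, (1 / (x + j) - 1 / (x + j + 1))
      = 1 / x - 1 / (x + n) := by
    intro n
    have := Finset.sum_range_sub' (fun j : ℕ => 1 / (x + (j : ℝ))) n
    simpa [add_assoc] using this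
  simp only [hsum]
  have hlim : Tendsto (fun n : ℕ => 1 / (x + n)) atTop (nhds 0) := by
    simpa only [one_div, Function.comp_def] using
      tendsto_inv_atTop_zero.comp (tendsto_atTop_add_const_left _ x tendsto_natCast_atTop_atTop)
  simpa using hlim.const_sub (1 / x)

lemma one_div_sq_le_inv_sub_inv {y : ℝ} (hy : 0 < y) :
    1 / (y + 1) ^ 2 ≤ 1 / y - 1 / (y + 1) := by
  have h : 1 / y - 1 / (y + 1) = 1 / (y * (y + 1)) := by field_simp; ring
  rw [h]
  exact one_div_le_one_div_of_le (by positivity) (by nlinarith)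

lemma inv_sub_inv_le_one_div_sq {y : ℝ} (hy : 0 < y) :
    1 / y - 1 / (y + 1) ≤ 1 / y ^ 2 := by
  have h : 1 / y - 1 / (y + 1) = 1 / (y * (y + 1)) := by field_simp; ring
  rw [h]
  exact one_div_le_one_div_of_le (by positivity) (by nlinarith)

lemma summable_one_div_add_sq {x : ℝ} (hx : 0 < x) :
    Summable (fun j : ℕ => 1 / (x + j + 1) ^ 2) :=
  Summable.of_nonneg_of_le (fun _ => by positivity)
    (fun j => one_div_sq_le_inv_sub_inv (y := x + j) (by positivity))
    (hasSum_inv_sub_inv_add_one hx).summable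

lemma tsum_one_div_add_sq_le {x : ℝ} (hx : 0 < x) :
    ∑' j : ℕ, 1 / (x + j + 1) ^ 2 ≤ 1 / x :=
  hasSum_le (fun j : ℕ => one_div_sq_le_inv_sub_inv (y := x + j) (by positivity))
    (summable_one_div_add_sq hx).hasSum (hasSum_inv_sub_inv_add_one hx)

lemma le_tsum_one_div_add_sq {x : ℝ} (hx : 0 < x) :
    1 / (x + 1) ≤ ∑' j : ℕ, 1 / (x + j + 1) ^ 2 := by
  refine hasSum_le (fun j : ℕ => ?_) (hasSum_inv_sub_inv_add_one (x := x + 1) (by positivity))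
    (summable_one_div_add_sq hx).hasSum
  have := inv_sub_inv_le_one_div_sq (y := x + j + 1) (by positivity)
  rwa [show x + 1 + (j : ℝ) = x + j + 1 by ring]

/-- `n ∑_{j ≥ 1} 1/(n a + j)²` tends to `1/a`. -/
lemma tendsto_mul_tsum_one_div_add_sq {a : ℝ} (ha : 0 < a) :
    Tendsto (fun n : ℕ => (n : ℝ) * ∑' j : ℕ, 1 / (n * a + j + 1) ^ 2) atTop
      (nhds (1 / a)) := by
  have hlow : Tendsto (fun n : ℕ => 1 / (a + 1 / (n : ℝ))) atTop (nhds (1 / a)) := by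
    have h : Tendsto (fun n : ℕ => a + 1 / (n : ℝ)) atTop (nhds a) := by
      simpa using tendsto_one_div_atTop_nhds_zero_nat.const_add a
    exact tendsto_const_nhds.div h ha.ne'
  refine tendsto_of_tendsto_of_tendsto_of_le_of_le' hlow tendsto_const_nhds ?_ ?_
  all_goals
    filter_upwards [eventually_gt_atTop 0] with n hn
    have hn' : (0 : ℝ) < n := by exact_mod_cast hn
    have hna : (0 : ℝ) < n * a := by positivity
  · calc 1 / (a + 1 / (n : ℝ)) = n * (1 / (n * a + 1)) := by field_simp
      _ ≤ _ := by gcongr; exact le_tsum_one_div_add_sq hna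
  · calc _ ≤ n * (1 / (n * a)) := by gcongr; exact tsum_one_div_add_sq_le hna
      _ = 1 / a := by field_simp

/-- `Lambda2 X` splits into the terms with index in `[0, n]` and two tails of constant sign. -/
lemma Lambda2_eq_sum_range_add_tails {X : ℝ} {n : ℕ} (h0 : 0 < X) (hn : X < n) :
    Lambda2 X = ∑ i ∈ Finset.range (n + 1), Real.sign (X - i) / |X - i| ^ 2
      - ∑' j : ℕ, 1 / ((n - X) + j + 1) ^ 2 + ∑' j : ℕ, 1 / (X + j + 1) ^ 2 := by
  have hneg : HasSum (fun j : ℕ => Real.sign (X - ((-(j + 1 : ℤ) : ℤ) : ℝ)) /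
      |X - ((-(j + 1 : ℤ) : ℤ) : ℝ)| ^ 2) (∑' j : ℕ, 1 / (X + j + 1) ^ 2) := by
    convert (summable_one_div_add_sq h0).hasSum using 2 with j
    push_cast
    rw [Real.sign_of_pos (by linarith [j.cast_nonneg (α := ℝ)]), sq_abs]
    congr 2
    ring
  have htail : HasSum (fun j : ℕ => Real.sign (X - ((j + (n + 1) : ℕ) : ℝ)) /
      |X - ((j + (n + 1) : ℕ) : ℝ)| ^ 2) (-∑' j : ℕ, 1 / ((n - X) + j + 1) ^ 2) := by
    have h := (summable_one_div_add_sq (sub_pos.2 hn)).hasSum.neg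
    refine Eq.subst (motive := fun f => HasSum f _) (funext fun j => ?_) h
    symm
    push_cast
    rw [Real.sign_of_neg (by linarith [j.cast_nonneg (α := ℝ)]), sq_abs, neg_div]
    congr 2
    ring
  have hpos := (hasSum_nat_add_iff (f := fun i : ℕ => Real.sign (X - (i : ℝ)) /
    |X - (i : ℝ)| ^ 2) (n + 1)).1 htail
  have hall := HasSum.of_nat_of_neg_add_one
    (f := fun i : ℤ => Real.sign (X - (i : ℝ)) / |X - (i : ℝ)| ^ 2)
    (by simpa only [Int.cast_natCast] using hpos) hneg
  rw [Lambda2, hall.tsum_eq]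
  ring

lemma S2_eq_inv_mul_sum {s : ℝ} {n : ℕ} (hn : 0 < n) :
    S2 s n = (n : ℝ)⁻¹ *
      ∑ i ∈ Finset.range (n + 1), Real.sign (n * s - i) / |n * s - i| ^ 2 := by
  have hn' : (0 : ℝ) < n := by exact_mod_cast hn
  rw [S2, Finset.mul_sum]
  refine Finset.sum_congr rfl fun i _ => ?_
  have h : (n : ℝ) * s - i = n * (s - i / n) := by field_simp
  have hsign : Real.sign (n * (s - i / n)) = Real.sign (s - i / n) := by
    rcases lt_trichotomy (s - (i : ℝ) / n) 0 with h | h | h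
    · rw [Real.sign_of_neg h, Real.sign_of_neg (mul_neg_of_pos_of_neg hn' h)]
    · rw [h, mul_zero]
    · rw [Real.sign_of_pos h, Real.sign_of_pos (mul_pos hn' h)]
  rw [h, hsign, abs_mul, abs_of_pos hn', mul_pow]
  simp only [div_eq_mul_inv, mul_inv]
  ring

/-- For irrational `s ∈ (0,1)`,
`lim_{n→∞} n² ( S₂(s, n) − n⁻¹ Λ₂(n s) ) = 1/(1−s) − 1/s`. -/
theorem S2_multiple_scales (s : ℝ) (hirr : Irrational s) (hs : s ∈ Set.Ioo (0 : ℝ) 1) :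
    Tendsto (fun n : ℕ => (n : ℝ) ^ 2 * (S2 s n - (n : ℝ)⁻¹ * Lambda2 (n * s))) atTop
      (nhds (1 / (1 - s) - 1 / s)) := by
  obtain ⟨h0, h1⟩ := hs
  refine ((tendsto_mul_tsum_one_div_add_sq (sub_pos.2 h1)).sub
    (tendsto_mul_tsum_one_div_add_sq h0)).congr' ?_
  filter_upwards [eventually_gt_atTop 0] with n hn
  have hn' : (0 : ℝ) < n := by exact_mod_cast hn
  rw [S2_eq_inv_mul_sum hn,
    Lambda2_eq_sum_range_add_tails (n := n) (mul_pos hn' h0) (by nlinarith),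
    show (n : ℝ) - n * s = n * (1 - s) by ring]
  field_simp
  ring
end

section
/- For every irrational s ∈ (0,1), lim_{n→∞} ( n² S₁(s, n) − 2 log n − Λ₁(n s) ) = log(s(1−s)), where S₁(s, n) = Σ_{i=0}^{n} n⁻³/|s − i/n|. -/
open Real Filter

/-- The finite sum `S₁(s, n) = Σ_{i=0}^{n} n⁻³/|s − i/n|`. -/
noncomputable def S1 (s : ℝ) (n : ℕ) : ℝ :=
  ∑ i ∈ Finset.range (n + 1), ((n : ℝ) ^ 3)⁻¹ / |s - (i : ℝ) / n|

/-- Partial sums of `1 / (y + i)` differ from `log (y + K)` by a convergent quantity, whose limit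
lies between `log y` and `log (y + 1)`. -/
lemma exists_tendsto_log_sub_sum_one_div_add {y : ℝ} (hy : 0 < y) :
    ∃ L ∈ Set.Icc (log y) (log (y + 1)),
      Tendsto (fun K : ℕ => log (y + K) - ∑ i ∈ Finset.range K, 1 / (y + (i + 1))) atTop
        (nhds L) := by
  set b : ℕ → ℝ := fun K => log (y + K) - ∑ i ∈ Finset.range K, 1 / (y + (i + 1)) with hb
  set c : ℕ → ℝ := fun K => log (y + (K + 1)) - ∑ i ∈ Finset.range K, 1 / (y + (i + 1)) with hc
  have hmono : Monotone b := by
    refine monotone_nat_of_le_succ fun K => ?_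
    have h := one_sub_inv_le_log_of_pos (x := (y + (K + 1)) / (y + K)) (by positivity)
    rw [log_div (by positivity) (by positivity)] at h
    have h' : 1 - ((y + (K + 1)) / (y + K))⁻¹ = 1 / (y + (K + 1)) := by
      field_simp
      ring
    simp only [hb, Finset.sum_range_succ, Nat.cast_add, Nat.cast_one]
    linarith
  have hanti : Antitone c := by
    refine antitone_nat_of_succ_le fun K => ?_
    have h := log_le_sub_one_of_pos (x := (y + (K + 1 + 1)) / (y + (K + 1))) (by positivity)
    rw [log_div (by positivity) (by positivity)] at h
    have h' : (y + (K + 1 + 1)) / (y + (K + 1)) - 1 = 1 / (y + (K + 1)) := by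
      field_simp
      ring
    simp only [hc, Finset.sum_range_succ, Nat.cast_add, Nat.cast_one]
    linarith
  have hlower (K : ℕ) : log y ≤ b K := by simpa [hb] using hmono (Nat.zero_le K)
  have hupper (K : ℕ) : b K ≤ log (y + 1) := by
    have h : b K ≤ c K := by
      simp only [hb, hc]
      gcongr
      linarith
    exact h.trans (by simpa [hc] using hanti (Nat.zero_le K))
  have hlim := tendsto_atTop_ciSup hmono ⟨_, Set.forall_mem_range.2 hupper⟩
  exact ⟨_, ⟨ge_of_tendsto' hlim hlower, le_of_tendsto' hlim hupper⟩, hlim⟩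

lemma tendsto_log_add_natCast_sub_log (x : ℝ) :
    Tendsto (fun K : ℕ => log (x + K) - log K) atTop (nhds 0) := by
  have h := (tendsto_log_comp_add_sub_log x).comp tendsto_natCast_atTop_atTop
  simpa [Function.comp_def, add_comm] using h

lemma sum_Icc_neg_eq_sum_range {M : Type*} [AddCommMonoid M] (f : ℤ → M) (K : ℕ) :
    ∑ i ∈ Finset.Icc (-(K : ℤ)) K, f i =
      ∑ i ∈ Finset.range (K + 1), f i + ∑ i ∈ Finset.range K, f (-(i + 1)) := by
  induction K with
  | zero => simp
  | succ K ih =>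
    have h : Finset.Icc (-((K + 1 : ℕ) : ℤ)) (K + 1 : ℕ) =
        insert (-((K : ℤ) + 1)) (insert ((K : ℤ) + 1) (Finset.Icc (-(K : ℤ)) K)) := by
      ext i
      simp only [Finset.mem_Icc, Finset.mem_insert]
      omega
    rw [h, Finset.sum_insert (by simp only [Finset.mem_Icc, Finset.mem_insert]; omega),
      Finset.sum_insert (by simp), ih, Finset.sum_range_succ _ (K + 1),
      Finset.sum_range_succ (fun i : ℕ => f (-(i + 1))) K]
    push_cast
    abel

/-- Splitting off the sites in `[0, n]` determines `Lambda1` up to two bounded logarithmic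
tails. -/
lemma sum_sub_Lambda1_mem_Icc {X : ℝ} {n : ℕ} (hX : 0 < X) (hXn : X < n) :
    ∑ i ∈ Finset.range (n + 1), 1 / |X - i| - Lambda1 X ∈
      Set.Icc (log X + log (n - X)) (log (X + 1) + log (n - X + 1)) := by
  obtain ⟨L, hL, hLlim⟩ := exists_tendsto_log_sub_sum_one_div_add hX
  obtain ⟨R, hR, hRlim⟩ := exists_tendsto_log_sub_sum_one_div_add (sub_pos.2 hXn)
  have hlim : Tendsto (fun K : ℕ => -2 * log K +
      ∑ i ∈ Finset.Icc (-(K : ℤ)) (K : ℤ), 1 / |X - (i : ℝ)|) atTop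
      (nhds (∑ i ∈ Finset.range (n + 1), 1 / |X - i| - L - R + 0 + 0)) := by
    rw [← tendsto_add_atTop_iff_nat n]
    have hl := (tendsto_log_add_natCast_sub_log X).comp (tendsto_add_atTop_nat n)
    have hr := (tendsto_log_add_natCast_sub_log (-X)).comp (tendsto_add_atTop_nat n)
    refine ((((hLlim.comp (tendsto_add_atTop_nat n)).const_sub _).sub hRlim).add hl).add hr
      |>.congr fun m => ?_
    rw [sum_Icc_neg_eq_sum_range, show m + n + 1 = n + 1 + m by ring,
      Finset.sum_range_add _ (n + 1) m]
    have h₁ : ∑ i ∈ Finset.range (m + n), 1 / |X - ((-((i : ℤ) + 1) : ℤ) : ℝ)| =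
        ∑ i ∈ Finset.range (m + n), 1 / (X + (i + 1)) := by
      refine Finset.sum_congr rfl fun i _ => ?_
      push_cast
      rw [sub_neg_eq_add, abs_of_pos (by positivity)]
    have h₂ : ∑ i ∈ Finset.range m, 1 / |X - (((n + 1 + i : ℕ) : ℤ) : ℝ)| =
        ∑ i ∈ Finset.range m, 1 / (n - X + (i + 1)) := by
      refine Finset.sum_congr rfl fun i _ => ?_
      push_cast
      rw [abs_sub_comm, abs_of_pos (by linarith [i.cast_nonneg (α := ℝ)])]
      ring_nf
    rw [h₁, h₂, show (n : ℝ) - X + m = -X + (m + n : ℕ) by push_cast; ring]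
    simp only [Function.comp_apply, Int.cast_natCast]
    ring
  have hΛ : Lambda1 X = _ := hlim.limUnder_eq
  rw [hΛ]
  constructor <;> linarith [hL.1, hL.2, hR.1, hR.2]

lemma sq_mul_S1 (s : ℝ) {n : ℕ} (hn : n ≠ 0) :
    (n : ℝ) ^ 2 * S1 s n = ∑ i ∈ Finset.range (n + 1), 1 / |n * s - i| := by
  have hn' : (0 : ℝ) < n := by positivity
  rw [S1, Finset.mul_sum]
  refine Finset.sum_congr rfl fun i _ => ?_
  rw [show (n : ℝ) * s - i = n * (s - i / n) by field_simp, abs_mul, abs_of_pos hn',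
    div_mul_eq_div_div, ← mul_div_assoc]
  congr 1
  field_simp

/-- For irrational `s ∈ (0,1)`,
`lim_{n→∞} ( n² S₁(s, n) − 2 log n − Λ₁(n s) ) = log(s(1−s))`. -/
theorem S1_multiple_scales (s : ℝ) (hirr : Irrational s) (hs : s ∈ Set.Ioo (0 : ℝ) 1) :
    Tendsto
      (fun n : ℕ => (n : ℝ) ^ 2 * S1 s n - 2 * Real.log n - Lambda1 (n * s)) atTop
      (nhds (Real.log (s * (1 - s)))) := by
  obtain ⟨hs₀, hs₁⟩ := hs
  have hs₁' : 0 < 1 - s := sub_pos.2 hs₁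
  have hinv : Tendsto (fun n : ℕ => (n : ℝ)⁻¹) atTop (nhds 0) :=
    tendsto_inv_atTop_nhds_zero_nat
  have hupper : Tendsto (fun n : ℕ => log ((s + (n : ℝ)⁻¹) * (1 - s + (n : ℝ)⁻¹))) atTop
      (nhds (log (s * (1 - s)))) := by
    have h := (hinv.const_add s).mul (hinv.const_add (1 - s))
    rw [add_zero, add_zero] at h
    exact h.log (by positivity)
  have hbounds : ∀ᶠ n : ℕ in atTop,
      (n : ℝ) ^ 2 * S1 s n - 2 * log n - Lambda1 (n * s) ∈
        Set.Icc (log (s * (1 - s))) (log ((s + (n : ℝ)⁻¹) * (1 - s + (n : ℝ)⁻¹))) := by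
    filter_upwards [eventually_ne_atTop 0] with n hn
    have hn' : (0 : ℝ) < n := by positivity
    obtain ⟨hlo, hhi⟩ := sum_sub_Lambda1_mem_Icc (X := n * s) (n := n) (by positivity)
      (mul_lt_of_lt_one_right hn' hs₁)
    rw [← sq_mul_S1 s hn] at hlo hhi
    rw [show (n : ℝ) - n * s = n * (1 - s) by ring, log_mul hn'.ne' hs₀.ne',
      log_mul hn'.ne' hs₁'.ne'] at hlo
    rw [show (n : ℝ) * s + 1 = n * (s + (n : ℝ)⁻¹) by field_simp,
      show (n : ℝ) - n * s + 1 = n * (1 - s + (n : ℝ)⁻¹) by field_simp,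
      log_mul hn'.ne' (by positivity), log_mul hn'.ne' (by positivity)] at hhi
    rw [log_mul hs₀.ne' hs₁'.ne', log_mul (by positivity) (by positivity)]
    constructor <;> linarith
  exact tendsto_of_tendsto_of_tendsto_of_le_of_le' tendsto_const_nhds hupper
    (hbounds.mono fun _ h => h.1) (hbounds.mono fun _ h => h.2)
end

section
/- Let w : ℝ → ℝ be smooth and 2π-periodic. Define u(θ) = w′(θ) + ε(−w′(θ)² + w″(θ)²/2) and the deformed-ring parametrization r_ε(s) = (1/(2π))(1 − ε·u(2πs))·(cos(2πs + ε·w(2πs)), sin(2πs + ε·w(2πs))) ∈ ℝ². Then there exists a constant C (depending only on w) such that for all ε ∈ [−1, 1] and all s ∈ ℝ, | ‖(d/ds) r_ε(s)‖² − 1 | ≤ C|ε|³. That is, this choice of radial displacement u makes the deformed ring inextensible to second order in ε. -/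
open Real Filter

/-- The radial displacement `u(θ) = w′(θ) + ε(−w′(θ)² + w″(θ)²/2)` determined by the
circumferential displacement `w` through the inextensibility condition. -/
noncomputable def uDisp (w : ℝ → ℝ) (ε θ : ℝ) : ℝ :=
  deriv w θ + ε * (-(deriv w θ) ^ 2 + (iteratedDeriv 2 w θ) ^ 2 / 2)

/-- The deformed-ring parametrization
`r_ε(s) = (1/(2π))(1 − ε u(2πs))·(cos(2πs + ε w(2πs)), sin(2πs + ε w(2πs)))`. -/
noncomputable def ringDeform (w : ℝ → ℝ) (ε s : ℝ) : ℝ × ℝ :=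
  ((1 / (2 * π)) * (1 - ε * uDisp w ε (2 * π * s))) •
    (Real.cos (2 * π * s + ε * w (2 * π * s)), Real.sin (2 * π * s + ε * w (2 * π * s)))

theorem Function.Periodic.deriv_of_real {f : ℝ → ℝ} {c : ℝ} (hf : Function.Periodic f c) :
    Function.Periodic (deriv f) c := fun x => by
  rw [← deriv_comp_add_const, funext hf]

theorem Function.Periodic.iteratedDeriv_of_real {f : ℝ → ℝ} {c : ℝ}
    (hf : Function.Periodic f c) (n : ℕ) : Function.Periodic (iteratedDeriv n f) c := by
  induction n with
  | zero => simpa using hf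
  | succ n ih => simpa only [iteratedDeriv_succ] using ih.deriv_of_real

/-- The squared speed of a plane curve in polar coordinates `(ρ, φ)` is `ρ′² + ρ²φ′²`. -/
theorem deriv_polar_sq_add_sq {ρ φ : ℝ → ℝ} {ρ' φ' s : ℝ} (hρ : HasDerivAt ρ ρ' s)
    (hφ : HasDerivAt φ φ' s) :
    (deriv (fun t => ρ t • (Real.cos (φ t), Real.sin (φ t))) s).1 ^ 2 +
      (deriv (fun t => ρ t • (Real.cos (φ t), Real.sin (φ t))) s).2 ^ 2 =
      ρ' ^ 2 + ρ s ^ 2 * φ' ^ 2 := by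
  have h : HasDerivAt (fun t => ρ t • (Real.cos (φ t), Real.sin (φ t))) _ s :=
    hρ.smul (hφ.cos.prodMk hφ.sin)
  rw [h.deriv]
  simp only [Prod.smul_mk, Prod.mk_add_mk, smul_eq_mul]
  linear_combination (ρ' ^ 2 + ρ s ^ 2 * φ' ^ 2) * Real.sin_sq_add_cos_sq (φ s)

theorem ContDiff.hasDerivAt_iteratedDeriv {w : ℝ → ℝ} (hw : ContDiff ℝ (⊤ : ℕ∞) w)
    (n : ℕ) (θ : ℝ) : HasDerivAt (iteratedDeriv n w) (iteratedDeriv (n + 1) w θ) θ := by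
  rw [iteratedDeriv_succ]
  exact (hw.differentiable_iteratedDeriv n (mod_cast ENat.natCast_lt_top n) θ).hasDerivAt

theorem hasDerivAt_uDisp {w : ℝ → ℝ} (hw : ContDiff ℝ (⊤ : ℕ∞) w) (ε θ : ℝ) :
    HasDerivAt (uDisp w ε) (iteratedDeriv 2 w θ +
      ε * (-2 * deriv w θ * iteratedDeriv 2 w θ + iteratedDeriv 2 w θ * iteratedDeriv 3 w θ))
      θ := by
  have h₁ : HasDerivAt (deriv w) (iteratedDeriv 2 w θ) θ := by
    simpa only [iteratedDeriv_one] using hw.hasDerivAt_iteratedDeriv 1 θ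
  have h₂ := hw.hasDerivAt_iteratedDeriv 2 θ
  refine (h₁.add (((h₁.pow 2).neg.add ((h₂.pow 2).div_const 2)).const_mul ε)).congr_deriv ?_
  push_cast
  ring

/-- The squared speed of the deformed ring in terms of `u` and the derivatives of `w`. -/
theorem ringDeform_speed_sq {w : ℝ → ℝ} (hw : ContDiff ℝ (⊤ : ℕ∞) w) (ε s : ℝ) :
    (deriv (ringDeform w ε) s).1 ^ 2 + (deriv (ringDeform w ε) s).2 ^ 2 =
      (ε * deriv (uDisp w ε) (2 * π * s)) ^ 2 +
        ((1 - ε * uDisp w ε (2 * π * s)) * (1 + ε * deriv w (2 * π * s))) ^ 2 := by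
  have hθ : HasDerivAt (fun t : ℝ => 2 * π * t) (2 * π) s := by
    simpa using (hasDerivAt_id s).const_mul (2 * π)
  have hu := (hasDerivAt_uDisp hw ε (2 * π * s)).differentiableAt.hasDerivAt
  have hw' : HasDerivAt w (deriv w (2 * π * s)) (2 * π * s) :=
    (hw.differentiable (by simp) _).hasDerivAt
  have hρ := (((hu.comp s hθ).const_mul ε).const_sub 1).const_mul (1 / (2 * π))
  have hφ := hθ.add ((hw'.comp s hθ).const_mul ε)
  refine (deriv_polar_sq_add_sq hρ hφ).trans ?_
  simp only [Function.comp_apply]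
  field_simp

/-- The deformed ring is inextensible to second order in `ε`: the squared Euclidean
speed `‖(d/ds) r_ε(s)‖²` equals `1` up to an `O(ε³)` error, uniformly in `s`. -/
theorem ring_inextensible (w : ℝ → ℝ) (hw : ContDiff ℝ (⊤ : ℕ∞) w)
    (hper : Function.Periodic w (2 * π)) :
    ∃ C : ℝ, ∀ ε ∈ Set.Icc (-1 : ℝ) 1, ∀ s : ℝ,
      |((deriv (ringDeform w ε) s).1 ^ 2 + (deriv (ringDeform w ε) s).2 ^ 2) - 1| ≤
        C * |ε| ^ 3 := by
  let J : ℝ → ℝ × ℝ × ℝ := fun θ => (deriv w θ, iteratedDeriv 2 w θ, iteratedDeriv 3 w θ)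
  have hJper : Function.Periodic J (2 * π) := fun θ => by
    simp only [J, hper.deriv_of_real θ, hper.iteratedDeriv_of_real _ θ]
  have hcont (n : ℕ) : Continuous (iteratedDeriv n w) :=
    continuous_iff_continuousAt.2 fun θ => (hw.hasDerivAt_iteratedDeriv n θ).continuousAt
  have hJcont : Continuous J :=
    (hw.continuous_deriv (by simp)).prodMk ((hcont 2).prodMk (hcont 3))
  have hJ : IsCompact (Set.range J) := hJper.compact_of_continuous Real.two_pi_pos.ne' hJcont
  let b : ℝ × ℝ × ℝ → ℝ := fun j => -2 * j.1 * j.2.1 + j.2.1 * j.2.2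
  let c : ℝ × ℝ × ℝ → ℝ := fun j => j.1 ^ 3 - j.1 * j.2.1 ^ 2 / 2
  let G : ℝ × ℝ × ℝ × ℝ → ℝ := fun x =>
    2 * x.2.2.1 * b x.2 + x.1 * b x.2 ^ 2 + 2 * c x.2 + x.1 * x.2.2.1 ^ 4 / 4
      - x.1 ^ 2 * x.2.2.1 ^ 2 * c x.2 + x.1 ^ 3 * c x.2 ^ 2
  have hG : Continuous G := by fun_prop
  obtain ⟨C, hC⟩ := ((isCompact_Icc (a := (-1 : ℝ)) (b := 1)).prod hJ).exists_bound_of_continuousOn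
    hG.continuousOn
  refine ⟨C, fun ε hε s => ?_⟩
  have hspeed : (deriv (ringDeform w ε) s).1 ^ 2 + (deriv (ringDeform w ε) s).2 ^ 2 - 1 =
      G (ε, J (2 * π * s)) * ε ^ 3 := by
    rw [ringDeform_speed_sq hw, (hasDerivAt_uDisp hw ε _).deriv]
    simp only [uDisp, G, b, c, J]
    ring
  rw [hspeed, abs_mul, abs_pow]
  gcongr
  exact hC (ε, J (2 * π * s)) ⟨hε, Set.mem_range_self _⟩
end
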